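/- arXiv:2012.11115 — 6 statements merged into one kernel-verified Lean document; each statement's English description precedes it below -/
import Mathlib

section
/- Let T = (T_1, …, T_d) be a projectively hyponormal commuting d-tuple of bounded operators on a complex separable Hilbert space H such that T is m-polynomially cyclic. If the Krull dimension of the quotient ring ℂ[z_1, …, z_d]/I_T equals 1, where I_T is the vanishing ideal of T, then [T_j*, T_i] is trace class for all 1 ≤ i, j ≤ d. -/
open ContinuousLinearMap MeasureTheory
open scoped ENNReal NNReal ComplexOrder

noncomputable section

variable {H H₁ H₂ K : Type*}
variable [NormedAddCommGroup H] [InnerProductSpace ℂ H] [CompleteSpace H]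
variable [NormedAddCommGroup H₁] [InnerProductSpace ℂ H₁] [CompleteSpace H₁]
variable [NormedAddCommGroup H₂] [InnerProductSpace ℂ H₂] [CompleteSpace H₂]
variable [NormedAddCommGroup K] [InnerProductSpace ℂ K] [CompleteSpace K]

/-- The commutator `[A, B] = A * B - B * A` of two bounded operators. -/
def cmt (A B : H →L[ℂ] H) : H →L[ℂ] H := A * B - B * A

/-- A bounded operator `T` is hyponormal if `[T*, T] ≥ 0`. -/
def Hyponormal (T : H →L[ℂ] H) : Prop := (cmt (adjoint T) T).IsPositive

/-- A `d`-tuple is projectively hyponormal if every linear combination is hyponormal. -/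
def ProjHyponormal {d : ℕ} (T : Fin d → H →L[ℂ] H) : Prop :=
  ∀ α : Fin d → ℂ, Hyponormal (∑ i, α i • T i)

/-- A `d`-tuple is jointly hyponormal if the block operator `(([T j*, T i]))` is
non-negative definite on the `d`-fold direct sum. -/
def JointlyHyponormal {d : ℕ} (T : Fin d → H →L[ℂ] H) : Prop :=
  ∀ x : Fin d → H, 0 ≤ ∑ i, ∑ j, @inner ℂ _ _ (x i) (cmt (adjoint (T j)) (T i) (x j))

/-- The trace norm `‖T‖₁ = sup Σ |⟨T fᵢ, gᵢ⟩|`, the supremum being taken over all pairs of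
(finite) orthonormal families. -/
def traceNorm (T : H →L[ℂ] H) : ℝ≥0∞ :=
  ⨆ (n : ℕ) (f : Fin n → H) (g : Fin n → H) (_ : Orthonormal ℂ f) (_ : Orthonormal ℂ g),
    ∑ i, (‖@inner ℂ _ _ (T (f i)) (g i)‖₊ : ℝ≥0∞)

/-- A bounded operator is trace class if its trace norm is finite. -/
def IsTraceClass (T : H →L[ℂ] H) : Prop := traceNorm T ≠ ⊤

/-- The Hilbert-Schmidt norm `‖T‖₂ = (Σ ‖T eₙ‖²)^(1/2)`. -/
def hsNorm (T : H →L[ℂ] H) : ℝ≥0∞ :=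
  (⨆ (n : ℕ) (f : Fin n → H) (_ : Orthonormal ℂ f), ∑ i, (‖T (f i)‖₊ : ℝ≥0∞) ^ 2) ^ (1/2 : ℝ)

/-- The word `T₁^(n 1) ⋯ T d^(n d)` in a `d`-tuple of operators. -/
def opWord {d : ℕ} (T : Fin d → H →L[ℂ] H) (n : Fin d → ℕ) : H →L[ℂ] H :=
  (List.ofFn fun j => (T j) ^ (n j)).prod

/-- A single operator is `m`-polynomially cyclic if `m` is the least cardinality of a finite
set `ξ` such that the span of `{T^n v : v ∈ ξ, n ≥ 0}` is dense. -/
def IsPolyCyclicOp (T : H →L[ℂ] H) (m : ℕ) : Prop :=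
  IsLeast {k : ℕ | ∃ ξ : Finset H, ξ.card = k ∧
    Dense ((Submodule.span ℂ {x | ∃ v ∈ ξ, ∃ n : ℕ, x = (T ^ n) v} : Submodule ℂ H) : Set H)} m

/-- A commuting `d`-tuple is `m`-polynomially cyclic if `m` is the least cardinality of a finite
set `ξ` such that the span of `{T₁^{i₁} ⋯ T_d^{i_d} v : v ∈ ξ}` is dense. -/
def IsPolyCyclicTuple {d : ℕ} (T : Fin d → H →L[ℂ] H) (m : ℕ) : Prop :=
  IsLeast {k : ℕ | ∃ ξ : Finset H, ξ.card = k ∧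
    Dense ((Submodule.span ℂ {x | ∃ v ∈ ξ, ∃ n : Fin d → ℕ, x = opWord T n v} :
      Submodule ℂ H) : Set H)} m

/-- The determinant operator `dEt [[T*, T]]` of the block operator of commutators
`B i j = [T j*, T i]`, given by the symmetrized Laplace expansion. -/
def detOp {d : ℕ} (T : Fin d → H →L[ℂ] H) : H →L[ℂ] H :=
  ∑ σ : Equiv.Perm (Fin d), ∑ τ : Equiv.Perm (Fin d),
    ((Equiv.Perm.sign σ : ℤ) •
      (List.ofFn fun k => cmt (adjoint (T (σ (τ k)))) (T (τ k))).prod)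

/-- The standard polynomial `S n (A 1, …, A n) = Σ_σ sgn σ • A σ(1) ⋯ A σ(n)`. -/
def stdPoly {n : ℕ} (A : Fin n → H →L[ℂ] H) : H →L[ℂ] H :=
  ∑ σ : Equiv.Perm (Fin n), ((Equiv.Perm.sign σ : ℤ) • (List.ofFn fun k => A (σ k)).prod)

/-- The generalized commutator `GC(T*, T) = S_{2d}(T₁*, T₁, …, T_d*, T_d)` of Helton-Howe. -/
def genComm {d : ℕ} (T : Fin d → H →L[ℂ] H) : H →L[ℂ] H :=
  stdPoly (fun j : Fin (2 * d) =>
    if (j : ℕ) % 2 = 0 then adjoint (T ⟨(j : ℕ) / 2, by have := j.isLt; omega⟩)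
    else T ⟨(j : ℕ) / 2, by have := j.isLt; omega⟩)

/-- `P` is the orthogonal projection onto the subspace `K'`. -/
def IsOrthProjOn (P : H →L[ℂ] H) (K' : Submodule ℂ H) : Prop :=
  IsSelfAdjoint P ∧ (∀ x, P x ∈ K') ∧ (∀ x ∈ K', P x = x)

/-- The subspace `H_N` spanned by words of total degree at most `N` applied to `ξ`. -/
def HN {d : ℕ} (T : Fin d → H →L[ℂ] H) (ξ : Finset H) (N : ℕ) : Submodule ℂ H :=
  Submodule.span ℂ {x | ∃ v ∈ ξ, ∃ n : Fin d → ℕ, (∑ j, n j) ≤ N ∧ x = opWord T n v}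

/-- The word `T*_{η 1} T_{τ 1} T*_{η 2} T_{τ 2} ⋯ T_{τ (d-1)} T*_{η d}`. -/
def wordB {d : ℕ} (T : Fin d → H →L[ℂ] H) (η τ : Equiv.Perm (Fin d)) : H →L[ℂ] H :=
  (List.ofFn fun k : Fin d =>
    if (k : ℕ) + 1 = d then adjoint (T (η k)) else adjoint (T (η k)) * T (τ k)).prod

/-- The operator `P_N (Σ_η sgn η T*_{η 1} T_{τ 1} ⋯ T*_{η d}) P_N^⊥ T_{τ d} P_N`. -/
def bsExpr {d : ℕ} (hd : 0 < d) (T : Fin d → H →L[ℂ] H) (P : ℕ → H →L[ℂ] H)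
    (τ : Equiv.Perm (Fin d)) (N : ℕ) : H →L[ℂ] H :=
  P N * (∑ η : Equiv.Perm (Fin d), (Equiv.Perm.sign η : ℤ) • wordB T η τ) *
    ((1 - P N) * T (τ ⟨d - 1, by omega⟩) * P N)

/-- The class `BS_{m, θ}`. -/
def InBS {d : ℕ} (hd : 0 < d) (T : Fin d → H →L[ℂ] H) (m θ : ℕ) : Prop :=
  IsPolyCyclicTuple T m ∧ (detOp T).IsPositive ∧
  ∃ ξ : Finset H, ξ.card = m ∧
    Dense ((Submodule.span ℂ {x | ∃ v ∈ ξ, ∃ n : Fin d → ℕ, x = opWord T n v} :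
      Submodule ℂ H) : Set H) ∧
    ∃ P : ℕ → H →L[ℂ] H, (∀ N, IsOrthProjOn (P N) (HN T ξ N)) ∧
      (∀ (N : ℕ) (j : Fin d), P N * T j * (1 - P N) = 0) ∧
      (∀ (τ : Equiv.Perm (Fin d)) (N : ℕ),
        ‖bsExpr hd T P τ N‖ ≤
          (θ : ℝ) * (((N + d - 1).choose (d - 1) : ℝ))⁻¹ * ∏ i, ‖T i‖ ^ 2)

/-- Evaluation of a polynomial in `d` commuting variables on a commuting `d`-tuple. -/
def evalPoly {d : ℕ} (T : Fin d → H →L[ℂ] H) (p : MvPolynomial (Fin d) ℂ) : H →L[ℂ] H :=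
  ∑ mo ∈ p.support, MvPolynomial.coeff mo p • opWord T (fun i => mo i)

/-- A pure hyponormal operator: no nonzero closed subspace, reducing for `T`, on which `T`
restricts to a normal operator. -/
def IsPureHyponormal (T : H →L[ℂ] H) : Prop :=
  Hyponormal T ∧ ∀ K' : Submodule ℂ H, IsClosed (K' : Set H) →
    (∀ x ∈ K', T x ∈ K') → (∀ x ∈ K', adjoint T x ∈ K') →
    (∀ x ∈ K', ‖T x‖ = ‖adjoint T x‖) → K' = ⊥

/-- `tmul` realises `H` as the Hilbert space tensor product of `H₁` and `H₂`. -/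
structure IsHilbertTensor (tmul : H₁ →ₗ[ℂ] H₂ →ₗ[ℂ] H) : Prop where
  inner_tmul : ∀ x₁ x₂ y₁ y₂,
    @inner ℂ _ _ (tmul x₁ x₂) (tmul y₁ y₂) = @inner ℂ _ _ x₁ y₁ * @inner ℂ _ _ x₂ y₂
  dense_span :
    Dense ((Submodule.span ℂ {z | ∃ x y, z = tmul x y} : Submodule ℂ H) : Set H)

/-- `C` is the tensor product operator `A ⊗ B` relative to `tmul`. -/
def IsTensorOp (tmul : H₁ →ₗ[ℂ] H₂ →ₗ[ℂ] H) (A : H₁ →L[ℂ] H₁) (B : H₂ →L[ℂ] H₂)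
    (C : H →L[ℂ] H) : Prop :=
  ∀ x y, C (tmul x y) = tmul (A x) (B y)
section AlgebraPart

/-- Noether normalization in dimension at most one. -/
lemma dy_krull {A : Type*} [CommRing A] [Algebra ℂ A] [Nontrivial A] [Algebra.FiniteType ℂ A]
    (hdim : ringKrullDim A ≤ 1) :
    ∃ s ≤ 1, ∃ g : MvPolynomial (Fin s) ℂ →ₐ[ℂ] A, g.Finite := by
  obtain ⟨s, g, hinj, hfin⟩ := exists_finite_inj_algHom_of_fg ℂ A
  refine ⟨s, ?_, g, hfin⟩
  letI := g.toRingHom.toAlgebra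
  have hint : Algebra.IsIntegral (MvPolynomial (Fin s) ℂ) A := by
    have : Module.Finite (MvPolynomial (Fin s) ℂ) A := hfin
    infer_instance
  have hfs : FaithfulSMul (MvPolynomial (Fin s) ℂ) A :=
    (faithfulSMul_iff_algebraMap_injective _ _).2 hinj
  have hle : ringKrullDim (MvPolynomial (Fin s) ℂ) ≤ ringKrullDim A := by
    refine iSup_le fun l => ?_
    obtain ⟨Q, hQ⟩ := Ideal.nonempty_primesOver (S := A) (RelSeries.head l).asIdeal
    have h1 := hQ.1
    have h2 := hQ.2
    obtain ⟨L, hL, -⟩ := Ideal.exists_ltSeries_of_hasGoingUp l Q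
    rw [← hL]
    exact le_iSup (fun L : LTSeries (PrimeSpectrum A) => (L.length : WithBot ℕ∞)) L
  rw [MvPolynomial.ringKrullDim_of_isNoetherianRing, ringKrullDim_eq_zero_of_field] at hle
  have := hle.trans hdim
  simp at this
  exact_mod_cast this

/-- The span of `w^k a_l`, `k ≤ K`. -/
def dyU {A : Type*} [CommRing A] [Algebra ℂ A] (w : A) {r : ℕ} (a : Fin r → A) (K : ℕ) :
    Submodule ℂ A := Submodule.span ℂ {x | ∃ k ≤ K, ∃ l, x = w ^ k * a l}

lemma dyU_mono {A : Type*} [CommRing A] [Algebra ℂ A] (w : A) {r : ℕ} (a : Fin r → A) :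
    Monotone (dyU w a) := by
  intro K L h
  refine Submodule.span_mono ?_
  rintro x ⟨k, hk, l, rfl⟩
  exact ⟨k, hk.trans h, l, rfl⟩

lemma dyU_mul {A : Type*} [CommRing A] [Algebra ℂ A] (w : A) {r : ℕ} (a : Fin r → A) (z : A)
    (D : ℕ) (hz : ∀ l, z * a l ∈ dyU w a D) {K : ℕ} {x : A} (hx : x ∈ dyU w a K) :
    z * x ∈ dyU w a (D + K) := by
  have key : ∀ (k : ℕ) (y : A), y ∈ dyU w a D → w ^ k * y ∈ dyU w a (D + k) := by
    intro k y hy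
    induction hy using Submodule.span_induction with
    | mem y hy =>
      obtain ⟨k', hk', l, rfl⟩ := hy
      exact Submodule.subset_span ⟨k + k', by omega, l, by ring⟩
    | zero => simp
    | add x y _ _ h1 h2 => rw [mul_add]; exact add_mem h1 h2
    | smul c x _ h => rw [mul_smul_comm]; exact Submodule.smul_mem _ _ h
  induction hx using Submodule.span_induction with
  | mem y hy =>
    obtain ⟨k, hk, l, rfl⟩ := hy
    have := key k _ (hz l)
    rw [mul_left_comm]
    exact dyU_mono w a (by omega) this
  | zero => simp
  | add x y _ _ h1 h2 => rw [mul_add]; exact add_mem h1 h2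
  | smul c x _ h => rw [mul_smul_comm]; exact Submodule.smul_mem _ _ h

lemma dy_gen {A : Type*} [CommRing A] [Algebra ℂ A] [Nontrivial A] [Algebra.FiniteType ℂ A]
    (hdim : ringKrullDim A ≤ 1) :
    ∃ (w : A) (r : ℕ) (a : Fin r → A), ∀ x : A, ∃ K, x ∈ dyU w a K := by
  obtain ⟨s, hs, g, hg⟩ := dy_krull hdim
  obtain ⟨w, hw⟩ : ∃ w : A, ∀ i, g (MvPolynomial.X i) = w := by
    rcases Nat.le_one_iff_eq_zero_or_eq_one.1 hs with rfl | rfl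
    · exact ⟨0, fun i => i.elim0⟩
    · exact ⟨g (MvPolynomial.X 0), fun i => by rw [Subsingleton.elim i 0]⟩
  letI := g.toRingHom.toAlgebra
  have hfin : Module.Finite (MvPolynomial (Fin s) ℂ) A := hg
  obtain ⟨r, a, ha⟩ := Module.Finite.exists_fin (R := MvPolynomial (Fin s) ℂ) (M := A)
  refine ⟨w, r, a, fun x => ?_⟩
  have hadd : ∀ x y : A, (∃ K, x ∈ dyU w a K) → (∃ K, y ∈ dyU w a K) →
      ∃ K, x + y ∈ dyU w a K := by
    rintro x y ⟨K, hK⟩ ⟨L, hL⟩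
    exact ⟨max K L, add_mem (dyU_mono w a (le_max_left _ _) hK)
      (dyU_mono w a (le_max_right _ _) hL)⟩
  have hx : x ∈ Submodule.span (MvPolynomial (Fin s) ℂ) (Set.range a) := by rw [ha]; trivial
  induction hx using Submodule.span_induction with
  | mem y hy =>
    obtain ⟨l, rfl⟩ := hy
    exact ⟨0, Submodule.subset_span ⟨0, le_rfl, l, by simp⟩⟩
  | zero => exact ⟨0, zero_mem _⟩
  | add x y _ _ h1 h2 => exact hadd x y h1 h2
  | smul p x _ h =>
    have e : p • x = g p * x := rfl
    rw [e]
    clear e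
    induction p using MvPolynomial.induction_on with
    | C c =>
      obtain ⟨K, hK⟩ := h
      refine ⟨K, ?_⟩
      have : g (MvPolynomial.C c) = algebraMap ℂ A c := g.commutes c
      rw [this, ← Algebra.smul_def]
      exact Submodule.smul_mem _ _ hK
    | add p q hp hq => rw [map_add, add_mul]; exact hadd _ _ hp hq
    | mul_X p i hp =>
      obtain ⟨K, hK⟩ := hp
      refine ⟨1 + K, ?_⟩
      rw [map_mul, hw, mul_comm (g p), mul_assoc]
      exact dyU_mul w a w 1
        (fun l => Submodule.subset_span ⟨1, le_rfl, l, by simp⟩) hK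

lemma dy_succ {d N : ℕ} (n : Fin d → ℕ) (h : ∑ j, n j = N + 1) :
    ∃ (j : Fin d) (n' : Fin d → ℕ), n = n' + Pi.single j 1 ∧ ∑ j, n' j = N := by
  obtain ⟨j, hj⟩ : ∃ j, n j ≠ 0 := by
    by_contra hc
    push Not at hc
    simp [hc] at h
  have e : n = (n - Pi.single j 1) + Pi.single j 1 := by
    funext i
    by_cases hi : i = j
    · subst hi; simp; omega
    · simp [hi]
  refine ⟨j, n - Pi.single j 1, e, ?_⟩
  rw [e] at h
  simp only [Pi.add_apply, Finset.sum_add_distrib] at h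
  rw [Finset.sum_pi_single'] at h
  simpa using h

lemma dy_prod_succ {A : Type*} [CommRing A] {d : ℕ} (z : Fin d → A) (n : Fin d → ℕ) (j : Fin d) :
    ∏ i, z i ^ (n + Pi.single j 1 : Fin d → ℕ) i = z j * ∏ i, z i ^ n i := by
  have : ∏ i, z i ^ (Pi.single j 1 : Fin d → ℕ) i = z j := by
    rw [Finset.prod_eq_single j]
    · simp
    · intro i _ hi; simp [hi]
    · simp
  simp only [Pi.add_apply, pow_add, Finset.prod_mul_distrib]
  rw [this, mul_comm]

lemma dy_growth {A : Type*} [CommRing A] [Algebra ℂ A] [Nontrivial A] [Algebra.FiniteType ℂ A]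
    (hdim : ringKrullDim A ≤ 1) {d : ℕ} (z : Fin d → A) :
    ∃ (w : A) (r : ℕ) (a : Fin r → A) (D : ℕ), ∀ (N : ℕ) (n : Fin d → ℕ), ∑ j, n j = N →
      ∏ j, z j ^ n j ∈ dyU w a (D * (N + 1)) := by
  obtain ⟨w, r, a, h⟩ := dy_gen hdim
  obtain ⟨D0, hD0⟩ := h 1
  choose f hf using fun (p : Fin d × Fin r) => h (z p.1 * a p.2)
  refine ⟨w, r, a, D0 + ∑ p, f p, fun N => ?_⟩
  have hD : ∀ j l, z j * a l ∈ dyU w a (D0 + ∑ p, f p) := fun j l =>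
    dyU_mono w a ((Finset.single_le_sum (f := f) (fun _ _ => Nat.zero_le _)
      (Finset.mem_univ (j, l))).trans (Nat.le_add_left _ _)) (hf (j, l))
  induction N with
  | zero =>
    intro n hn
    have : ∀ j, n j = 0 := by simpa using hn
    simp only [this, pow_zero, Finset.prod_const_one]
    exact dyU_mono w a (by simp) hD0
  | succ N ih =>
    intro n hn
    obtain ⟨j, n', rfl, hn'⟩ := dy_succ n hn
    rw [dy_prod_succ]
    have := dyU_mul w a (z j) _ (hD j) (ih n' hn')
    exact dyU_mono w a (by ring_nf; rfl) this

end AlgebraPart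

section OperatorAlgebra

lemma dy_phi {d : ℕ} (T : Fin d → H →L[ℂ] H) (hcomm : ∀ i j, Commute (T i) (T j)) :
    ∃ φ : MvPolynomial (Fin d) ℂ →ₐ[ℂ] (H →L[ℂ] H), (∀ j, φ (MvPolynomial.X j) = T j) ∧
      (∀ n : Fin d → ℕ, φ (∏ j, MvPolynomial.X j ^ n j) = opWord T n) ∧
      ∀ p, φ p = evalPoly T p := by
  have hc := Algebra.isMulCommutative_adjoin ℂ (s := Set.range T) (by
    rintro _ ⟨i, rfl⟩ _ ⟨j, rfl⟩; exact hcomm i j)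
  open scoped IsMulCommutative in
  let φ : MvPolynomial (Fin d) ℂ →ₐ[ℂ] (H →L[ℂ] H) :=
    (Algebra.adjoin ℂ (Set.range T)).val.comp
      (MvPolynomial.aeval fun j => ⟨T j, Algebra.subset_adjoin ⟨j, rfl⟩⟩)
  have h1 : ∀ j, φ (MvPolynomial.X j) = T j := fun j => by simp [φ]
  have h2 : ∀ n : Fin d → ℕ, φ (∏ j, MvPolynomial.X j ^ n j) = opWord T n := by
    intro n
    rw [← List.prod_ofFn, map_list_prod, List.map_ofFn, opWord]
    congr 2
    funext j
    simp [h1]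
  refine ⟨φ, h1, h2, fun p => ?_⟩
  conv_lhs => rw [p.as_sum]
  rw [map_sum, evalPoly]
  refine Finset.sum_congr rfl fun n _ => ?_
  rw [← h2, ← map_smul]
  congr 1
  rw [MvPolynomial.monomial_eq, Finsupp.prod_fintype _ _ (by simp), MvPolynomial.smul_eq_C_mul]

lemma HN_mono {d : ℕ} (T : Fin d → H →L[ℂ] H) (ξ : Finset H) : Monotone (HN T ξ) := by
  intro N M h
  refine Submodule.span_mono ?_
  rintro x ⟨v, hv, n, hn, rfl⟩
  exact ⟨v, hv, n, hn.trans h, rfl⟩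

lemma HN_map {d : ℕ} (T : Fin d → H →L[ℂ] H) (hcomm : ∀ i j, Commute (T i) (T j))
    (ξ : Finset H) (N : ℕ) (j : Fin d) {x : H} (hx : x ∈ HN T ξ N) : T j x ∈ HN T ξ (N + 1) := by
  obtain ⟨φ, h1, h2, -⟩ := dy_phi T hcomm
  induction hx using Submodule.span_induction with
  | mem y hy =>
    obtain ⟨v, hv, n, hn, rfl⟩ := hy
    refine Submodule.subset_span ⟨v, hv, n + Pi.single j 1, ?_, ?_⟩
    · simp only [Pi.add_apply, Finset.sum_add_distrib]
      rw [Finset.sum_pi_single']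
      simpa using hn
    · rw [← h2 (n + Pi.single j 1), dy_prod_succ, map_mul, h1, h2]; rfl
  | zero => simp
  | add x y _ _ h1 h2 => rw [map_add]; exact add_mem h1 h2
  | smul c x _ h => rw [map_smul]; exact Submodule.smul_mem _ _ h

lemma HN_growth {d : ℕ} (T : Fin d → H →L[ℂ] H) (hcomm : ∀ i j, Commute (T i) (T j))
    (ξ : Finset H)
    (hKrull : ringKrullDim (MvPolynomial (Fin d) ℂ ⧸
        Ideal.span {p : MvPolynomial (Fin d) ℂ | evalPoly T p = 0}) = 1) :
    ∃ C : ℕ, ∀ N, FiniteDimensional ℂ (HN T ξ N) ∧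
      Module.finrank ℂ (HN T ξ N) ≤ C * (N + 1) := by
  obtain ⟨φ, h1, h2, h3⟩ := dy_phi T hcomm
  set I := Ideal.span {p : MvPolynomial (Fin d) ℂ | evalPoly T p = 0} with hI
  have hφI : ∀ p ∈ I, φ p = 0 := by
    have : I ≤ RingHom.ker φ := Ideal.span_le.2 fun p hp => by
      simpa [RingHom.mem_ker, h3] using hp
    exact fun p hp => this hp
  let Φ : (MvPolynomial (Fin d) ℂ ⧸ I) →ₐ[ℂ] (H →L[ℂ] H) := Ideal.Quotient.liftₐ I φ hφI
  have hΦ : ∀ p, Φ (Ideal.Quotient.mk I p) = φ p := fun p => rfl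
  have hnt : Nontrivial (MvPolynomial (Fin d) ℂ ⧸ I) := by
    by_contra hc
    rw [not_nontrivial_iff_subsingleton] at hc
    rw [ringKrullDim_eq_bot_of_subsingleton] at hKrull
    exact absurd hKrull (by decide)
  obtain ⟨w, r, a, D, hw⟩ := dy_growth hKrull.le (fun j => Ideal.Quotient.mk I (MvPolynomial.X j))
  refine ⟨(D + 1) * (r * ξ.card), fun N => ?_⟩
  let f : Fin (D * (N + 1) + 1) × Fin r × ξ → H := fun q => Φ (w ^ (q.1 : ℕ) * a q.2.1) q.2.2
  have hfd : FiniteDimensional ℂ (Submodule.span ℂ (Set.range f)) :=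
    FiniteDimensional.span_of_finite _ (Set.finite_range f)
  have hle : HN T ξ N ≤ Submodule.span ℂ (Set.range f) := by
    refine Submodule.span_le.2 ?_
    rintro x ⟨v, hv, n, hn, rfl⟩
    have hmem := dyU_mono w a (Nat.mul_le_mul_left D (Nat.succ_le_succ hn)) (hw _ n rfl)
    have e : opWord T n = Φ (∏ j, Ideal.Quotient.mk I (MvPolynomial.X j) ^ n j) := by
      rw [← h2, ← hΦ]; simp
    rw [e]
    generalize (∏ j, Ideal.Quotient.mk I (MvPolynomial.X j) ^ n j) = y at hmem
    induction hmem using Submodule.span_induction with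
    | mem y hy =>
      obtain ⟨k, hk, l, rfl⟩ := hy
      exact Submodule.subset_span ⟨(⟨k, Nat.lt_succ_of_le hk⟩, l, ⟨v, hv⟩), rfl⟩
    | zero => simp
    | add x y _ _ h1 h2 => rw [map_add]; exact add_mem h1 h2
    | smul c x _ h => rw [map_smul]; exact Submodule.smul_mem _ _ h
  refine ⟨Submodule.finiteDimensional_of_le hle, ?_⟩
  calc Module.finrank ℂ (HN T ξ N) ≤ Module.finrank ℂ (Submodule.span ℂ (Set.range f)) :=
        Submodule.finrank_mono hle
    _ ≤ Fintype.card (Fin (D * (N + 1) + 1) × Fin r × ξ) := finrank_range_le_card f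
    _ = (D * (N + 1) + 1) * (r * ξ.card) := by simp
    _ ≤ ((D + 1) * (N + 1)) * (r * ξ.card) := Nat.mul_le_mul_right _ (by nlinarith)
    _ = _ := by ring

lemma dy_freq (h : ℕ → ℕ) (C : ℕ) (hC : ∀ N, h N ≤ C * (N + 1)) (N0 : ℕ) :
    ∃ N ≥ N0, h (N + 1) ≤ h N + C := by
  by_contra hc
  push Not at hc
  have : ∀ k, k * (C + 1) ≤ h (N0 + k) := by
    intro k
    induction k with
    | zero => simp
    | succ k ih =>
      have := hc (N0 + k) (by omega)
      rw [← add_assoc]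
      nlinarith
  have h1 := this (C * (N0 + 1) + 1)
  have h2 := hC (N0 + (C * (N0 + 1) + 1))
  nlinarith

end OperatorAlgebra
section TracePart

lemma dy_sum_proj (V : Submodule ℂ H) [FiniteDimensional ℂ V] {ι : Type*} [Fintype ι]
    (e : OrthonormalBasis ι ℂ V) (x : H) :
    ∑ k, ‖inner ℂ (e k : H) x‖ ^ 2 = ‖V.starProjection x‖ ^ 2 := by
  have h := e.sum_sq_norm_inner_right (V.orthogonalProjectionOnto x)
  have h2 : ‖V.starProjection x‖ = ‖V.orthogonalProjectionOnto x‖ := rfl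
  rw [h2, ← h]
  refine Finset.sum_congr rfl fun k _ => ?_
  congr 2
  exact (Submodule.inner_orthogonalProjectionOnto_eq_of_mem_left (e k) x).symm

lemma dy_bessel {ι : Type*} [Fintype ι] {f : ι → H} (hf : Orthonormal ℂ f) (x : H) :
    ∑ k, ‖inner ℂ (f k) x‖ ^ 2 ≤ ‖x‖ ^ 2 := hf.sum_inner_products_le x

lemma dy_coe_orth (V : Submodule ℂ H) {ι : Type*} [Fintype ι]
    (e : OrthonormalBasis ι ℂ V) : Orthonormal ℂ (fun k => (e k : H)) :=
  e.orthonormal.comp_linearIsometry V.subtypeₗᵢ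

/-- The core Berger-Shaw estimate. -/
lemma dy_bs (S : H →L[ℂ] H) (V W : Submodule ℂ H) [FiniteDimensional ℂ V]
    [FiniteDimensional ℂ W] (hVW : V ≤ W) (hS : ∀ x ∈ V, S x ∈ W) {ι : Type*} [Fintype ι]
    (e : OrthonormalBasis ι ℂ V) (c : ℕ)
    (hc : Module.finrank ℂ W ≤ Module.finrank ℂ V + c) :
    ∑ i, (‖S (e i)‖ ^ 2 - ‖adjoint S (e i)‖ ^ 2) ≤ c * ‖S‖ ^ 2 := by
  set K : Submodule ℂ H := Vᗮ ⊓ W with hK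
  have hKfd : FiniteDimensional ℂ K := Submodule.finiteDimensional_of_le inf_le_right
  have hKr : Module.finrank ℂ K ≤ c := by
    have := Submodule.finrank_add_inf_finrank_orthogonal hVW
    rw [← hK] at this
    omega
  let f := stdOrthonormalBasis ℂ K
  have h1 : ∀ i, ‖S (e i)‖ ^ 2 ≤ ∑ k, ‖inner ℂ (e k : H) (S (e i))‖ ^ 2 +
      ∑ j, ‖inner ℂ (f j : H) (S (e i))‖ ^ 2 := by
    intro i
    set x := S (e i) with hx
    have hxW : x ∈ W := hS _ (e i).2
    rw [dy_sum_proj, dy_sum_proj, Submodule.norm_sq_eq_add_norm_sq_starProjection x V]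
    have hmem : Vᗮ.starProjection x ∈ K := by
      refine ⟨Submodule.starProjection_apply_mem _ _, ?_⟩
      have : Vᗮ.starProjection x = x - V.starProjection x := by
        rw [Submodule.starProjection_orthogonal_val]
      rw [this]
      exact sub_mem hxW (hVW (Submodule.starProjection_apply_mem _ _))
    have : K.starProjection x = Vᗮ.starProjection x := by
      refine Submodule.eq_starProjection_of_mem_of_inner_eq_zero hmem ?_
      intro w hw
      have : x - Vᗮ.starProjection x = V.starProjection x := by
        rw [Submodule.starProjection_orthogonal_val]; simp
      rw [this]
      exact (Submodule.mem_inf.1 hw).1 _ (Submodule.starProjection_apply_mem _ _)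
    rw [this]
  have hsw : ∀ x y : H, ‖inner ℂ x (S y)‖ = ‖inner ℂ y (adjoint S x)‖ := by
    intro x y
    rw [adjoint_inner_right, ← inner_conj_symm, RCLike.norm_conj]
  have h2 : ∑ i, ∑ k, ‖inner ℂ (e k : H) (S (e i))‖ ^ 2 ≤ ∑ k, ‖adjoint S (e k)‖ ^ 2 := by
    rw [Finset.sum_comm]
    refine Finset.sum_le_sum fun k _ => ?_
    simp_rw [hsw]
    exact dy_bessel (dy_coe_orth V e) _
  have h3 : ∑ i, ∑ j, ‖inner ℂ (f j : H) (S (e i))‖ ^ 2 ≤ c * ‖S‖ ^ 2 := by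
    rw [Finset.sum_comm]
    calc _ ≤ ∑ j : Fin (Module.finrank ℂ K), ‖S‖ ^ 2 := by
          refine Finset.sum_le_sum fun j _ => ?_
          simp_rw [hsw]
          refine (dy_bessel (dy_coe_orth V e) _).trans ?_
          have hn : ‖(f j : H)‖ = 1 := (dy_coe_orth K f).1 j
          have := (adjoint S).le_opNorm (f j : H)
          rw [hn, mul_one, LinearIsometryEquiv.norm_map] at this
          gcongr
      _ = (Module.finrank ℂ K : ℝ) * ‖S‖ ^ 2 := by simp
      _ ≤ _ := by gcongr
  rw [Finset.sum_sub_distrib]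
  have h4 := Finset.sum_le_sum fun i (_ : i ∈ Finset.univ) => h1 i
  rw [Finset.sum_add_distrib] at h4
  linarith

/-- Basis independence inequality. -/
lemma dy_hs (R : H →L[ℂ] H) (V : Submodule ℂ H) [FiniteDimensional ℂ V] {ι κ : Type*} [Fintype ι]
    [Fintype κ] (e : OrthonormalBasis ι ℂ V) {f : κ → H} (hf : Orthonormal ℂ f) :
    ∑ i, ‖R (V.starProjection (f i))‖ ^ 2 ≤ ∑ k, ‖R (e k)‖ ^ 2 := by
  let W := V.map (R : H →ₗ[ℂ] H)
  have hW : ∀ x ∈ V, R x ∈ W := fun x hx => ⟨x, hx, rfl⟩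
  let g := stdOrthonormalBasis ℂ W
  have hg : ∀ x ∈ V, ‖R x‖ ^ 2 = ∑ j, ‖inner ℂ (g j : H) (R x)‖ ^ 2 := by
    intro x hx
    rw [dy_sum_proj, Submodule.starProjection_eq_self_iff.2 (hW x hx)]
  have hsw : ∀ x y : H, ‖inner ℂ x (R y)‖ = ‖inner ℂ y (adjoint R x)‖ := by
    intro x y
    rw [adjoint_inner_right, ← inner_conj_symm, RCLike.norm_conj]
  calc ∑ i, ‖R (V.starProjection (f i))‖ ^ 2
      = ∑ i, ∑ j, ‖inner ℂ (f i) (V.starProjection (adjoint R (g j)))‖ ^ 2 := by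
        refine Finset.sum_congr rfl fun i _ => ?_
        rw [hg _ (Submodule.starProjection_apply_mem _ _)]
        refine Finset.sum_congr rfl fun j _ => ?_
        rw [hsw, Submodule.inner_starProjection_left_eq_right]
    _ ≤ ∑ j, ‖V.starProjection (adjoint R (g j))‖ ^ 2 := by
        rw [Finset.sum_comm]
        exact Finset.sum_le_sum fun j _ => dy_bessel hf _
    _ = ∑ j, ∑ k, ‖inner ℂ (e k : H) (adjoint R (g j))‖ ^ 2 := by
        refine Finset.sum_congr rfl fun j _ => (dy_sum_proj V e _).symm
    _ = ∑ k, ‖R (e k)‖ ^ 2 := by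
        rw [Finset.sum_comm]
        refine Finset.sum_congr rfl fun k _ => ?_
        rw [hg _ (e k).2]
        simp_rw [hsw]

lemma dy_pos (S : H →L[ℂ] H) (hS : Hyponormal S) :
    ∃ R : H →L[ℂ] H, cmt (adjoint S) S = adjoint R * R ∧
      ∀ x, ‖R x‖ ^ 2 = ‖S x‖ ^ 2 - ‖adjoint S x‖ ^ 2 := by
  obtain ⟨R, hR⟩ := CStarAlgebra.nonneg_iff_eq_star_mul_self.1
    ((ContinuousLinearMap.nonneg_iff_isPositive _).2 hS)
  rw [ContinuousLinearMap.star_eq_adjoint] at hR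
  refine ⟨R, hR, fun x => ?_⟩
  have h1 : ∀ A : H →L[ℂ] H, inner ℂ ((adjoint A * A) x) x = ((‖A x‖ ^ 2 : ℝ) : ℂ) := by
    intro A
    rw [ContinuousLinearMap.mul_apply, adjoint_inner_left, inner_self_eq_norm_sq_to_K]
    simp
  have h2 := h1 (adjoint S)
  rw [adjoint_adjoint] at h2
  have h3 := h1 R
  rw [← hR, cmt, ContinuousLinearMap.sub_apply, inner_sub_left, h1 S, h2] at h3
  exact_mod_cast h3.symm

lemma dy_traceBound (S : H →L[ℂ] H) (hS : Hyponormal S) (U : ℕ → Submodule ℂ H)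
    (hU : Monotone U) (hfd : ∀ N, FiniteDimensional ℂ (U N)) (hd : ⊤ ≤ (⨆ N, U N).topologicalClosure)
    (hSU : ∀ N, ∀ x ∈ U N, S x ∈ U (N + 1)) (c : ℕ)
    (hc : ∀ N0, ∃ N ≥ N0, Module.finrank ℂ (U (N + 1)) ≤ Module.finrank ℂ (U N) + c)
    (n : ℕ) (f g : Fin n → H) (hf : Orthonormal ℂ f) (hg : Orthonormal ℂ g) :
    ∑ i, ‖inner ℂ (cmt (adjoint S) S (f i)) (g i)‖ ≤ c * ‖S‖ ^ 2 := by
  obtain ⟨R, hR, hR2⟩ := dy_pos S hS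
  have key : ∀ f : Fin n → H, Orthonormal ℂ f → ∑ i, ‖R (f i)‖ ^ 2 ≤ c * ‖S‖ ^ 2 := by
    intro f hf
    have hlim : Filter.Tendsto (fun N => ∑ i, ‖R ((U N).starProjection (f i))‖ ^ 2) Filter.atTop
        (nhds (∑ i, ‖R (f i)‖ ^ 2)) := by
      refine tendsto_finsetSum _ fun i _ => ?_
      have := Submodule.starProjection_tendsto_self U hU (f i) hd
      exact ((R.continuous.tendsto _).comp this).norm.pow 2
    refine le_of_tendsto_of_frequently hlim ?_
    rw [Filter.frequently_atTop]
    intro N0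
    obtain ⟨N, hN, h⟩ := hc N0
    refine ⟨N, hN, ?_⟩
    refine (dy_hs R (U N) (stdOrthonormalBasis ℂ (U N)) hf).trans ?_
    simp_rw [hR2]
    exact dy_bs S (U N) (U (N + 1)) (hU (Nat.le_succ N)) (hSU N) _ c h
  have hle : ∀ i, ‖inner ℂ (cmt (adjoint S) S (f i)) (g i)‖ ≤
      (‖R (f i)‖ ^ 2 + ‖R (g i)‖ ^ 2) / 2 := by
    intro i
    rw [hR, ContinuousLinearMap.mul_apply, adjoint_inner_left]
    have := norm_inner_le_norm (𝕜 := ℂ) (R (f i)) (R (g i))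
    nlinarith [sq_nonneg (‖R (f i)‖ - ‖R (g i)‖)]
  refine (Finset.sum_le_sum fun i _ => hle i).trans ?_
  rw [← Finset.sum_div, Finset.sum_add_distrib]
  linarith [key f hf, key g hg]

lemma dy_isTraceClass (A : H →L[ℂ] H) (C : ℝ)
    (h : ∀ (n : ℕ) (f g : Fin n → H), Orthonormal ℂ f → Orthonormal ℂ g →
      ∑ i, ‖inner ℂ (A (f i)) (g i)‖ ≤ C) : IsTraceClass A := by
  refine ne_top_of_le_ne_top (ENNReal.ofReal_ne_top (r := C)) ?_
  refine iSup_le fun n => iSup_le fun f => iSup_le fun g => iSup_le fun hf => iSup_le fun hg => ?_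
  refine le_trans (le_of_eq ?_) (ENNReal.ofReal_le_ofReal (h n f g hf hg))
  rw [ENNReal.ofReal_sum_of_nonneg (fun _ _ => norm_nonneg _)]
  refine Finset.sum_congr rfl fun i _ => ?_
  rw [ofReal_norm]
  rfl

lemma dy_polar (A B : H →L[ℂ] H) :
    cmt (adjoint B) A = (4⁻¹ : ℂ) • (cmt (adjoint (A + B)) (A + B) - cmt (adjoint (A - B)) (A - B)
      + Complex.I • cmt (adjoint (A + Complex.I • B)) (A + Complex.I • B)
      - Complex.I • cmt (adjoint (A - Complex.I • B)) (A - Complex.I • B)) := by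
  have hI : (starRingEnd ℂ) Complex.I = -Complex.I := Complex.conj_I
  simp only [cmt, map_add, map_sub, map_smulₛₗ, hI, mul_add, add_mul, sub_mul, mul_sub,
    smul_mul_assoc, mul_smul_comm, smul_add, smul_sub, smul_smul, neg_smul, Complex.I_mul_I,
    neg_mul, mul_neg]
  match_scalars <;> ring_nf <;> simp [Complex.I_sq] <;> norm_num

end TracePart

/-- the Douglas-Yan theorem with projective hyponormality: if the tuple is
finitely polynomially cyclic and `ℂ[z]/I_T` has Krull dimension `1`, then all commutators
`[T j*, T i]` are trace class. -/
theorem statement_8 {d : ℕ} [TopologicalSpace.SeparableSpace H]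
    (T : Fin d → H →L[ℂ] H) (hcomm : ∀ i j, Commute (T i) (T j))
    (hph : ProjHyponormal T) (m : ℕ) (hcyc : IsPolyCyclicTuple T m)
    (hKrull : ringKrullDim (MvPolynomial (Fin d) ℂ ⧸
        Ideal.span {p : MvPolynomial (Fin d) ℂ | evalPoly T p = 0}) = 1) :
    ∀ i j, IsTraceClass (cmt (adjoint (T j)) (T i)) := by
  classical
  obtain ⟨ξ, -, hξ⟩ := hcyc.1
  obtain ⟨C, hC⟩ := HN_growth T hcomm ξ hKrull
  have hdense : ⊤ ≤ (⨆ N, HN T ξ N).topologicalClosure := by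
    have hle : Submodule.span ℂ {x | ∃ v ∈ ξ, ∃ n : Fin d → ℕ, x = opWord T n v} ≤
        ⨆ N, HN T ξ N := by
      refine Submodule.span_le.2 ?_
      rintro x ⟨v, hv, n, rfl⟩
      exact Submodule.mem_iSup_of_mem (∑ j, n j) (Submodule.subset_span ⟨v, hv, n, le_rfl, rfl⟩)
    intro x _
    exact closure_mono hle (hξ x)
  have key : ∀ α : Fin d → ℂ, ∃ c : ℝ, ∀ (n : ℕ) (f g : Fin n → H), Orthonormal ℂ f →
      Orthonormal ℂ g → ∑ i, ‖inner ℂ (cmt (adjoint (∑ i, α i • T i)) (∑ i, α i • T i) (f i)) (g i)‖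
        ≤ c := by
    intro α
    refine ⟨C * ‖∑ i, α i • T i‖ ^ 2, fun n f g hf hg => ?_⟩
    refine dy_traceBound _ (hph α) (HN T ξ) (HN_mono T ξ) (fun N => (hC N).1) hdense ?_ C
      (dy_freq _ C fun N => (hC N).2) n f g hf hg
    intro N x hx
    rw [ContinuousLinearMap.sum_apply]
    exact sum_mem fun j _ => Submodule.smul_mem _ _ (HN_map T hcomm ξ N j hx)
  intro i j
  have hsum : ∀ c : ℂ, ∑ k, (Pi.single i 1 + Pi.single j c : Fin d → ℂ) k • T k
      = T i + c • T j := by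
    intro c
    simp [add_smul, Finset.sum_add_distrib, Pi.single_apply, ite_smul]
  have key' : ∀ c : ℂ, ∃ b : ℝ, ∀ (n : ℕ) (f g : Fin n → H), Orthonormal ℂ f →
      Orthonormal ℂ g →
      ∑ k, ‖inner ℂ (cmt (adjoint (T i + c • T j)) (T i + c • T j) (f k)) (g k)‖ ≤ b := by
    intro c
    obtain ⟨b, hb⟩ := key (Pi.single i 1 + Pi.single j c)
    rw [hsum] at hb
    exact ⟨b, hb⟩
  obtain ⟨b1, h1⟩ := key' 1
  obtain ⟨b2, h2⟩ := key' (-1)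
  obtain ⟨b3, h3⟩ := key' Complex.I
  obtain ⟨b4, h4⟩ := key' (-Complex.I)
  simp only [one_smul, neg_smul, ← sub_eq_add_neg] at h1 h2 h3 h4
  refine dy_isTraceClass _ (b1 + b2 + b3 + b4) fun n f g hf hg => ?_
  have g1 := h1 n f g hf hg
  have g2 := h2 n f g hf hg
  have g3 := h3 n f g hf hg
  have g4 := h4 n f g hf hg
  refine le_trans ?_ (add_le_add (add_le_add (add_le_add g1 g2) g3) g4)
  rw [← Finset.sum_add_distrib, ← Finset.sum_add_distrib, ← Finset.sum_add_distrib]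
  refine Finset.sum_le_sum fun k _ => ?_
  rw [dy_polar (T i) (T j)]
  simp only [ContinuousLinearMap.smul_apply, ContinuousLinearMap.add_apply,
    ContinuousLinearMap.sub_apply, inner_smul_left, inner_add_left, inner_sub_left]
  rw [norm_mul]
  have h4 : ‖(starRingEnd ℂ) (4⁻¹ : ℂ)‖ ≤ 1 := by
    rw [RCLike.norm_conj]; norm_num
  refine (mul_le_of_le_one_left (norm_nonneg _) h4).trans ?_
  refine (norm_sub_le _ _).trans (add_le_add ((norm_add_le _ _).trans
    (add_le_add (norm_sub_le _ _) ?_)) ?_) <;> simp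
end
end

section
/- Let T = (T_1, T_2) be a commuting pair of bounded operators on a complex separable Hilbert space H such that the pair is projectively hyponormal, each T_i is pure (has no nonzero reducing subspace on which it is normal), and T is m-polynomially cyclic. If there exists a nonzero polynomial p ∈ ℂ[z_1, z_2] with p(T_1, T_2) = 0, then [T_j*, T_i] is trace class for all 1 ≤ i, j ≤ 2. -/
open ContinuousLinearMap MeasureTheory
open scoped ENNReal NNReal ComplexOrder

noncomputable section

variable {H H₁ H₂ K : Type*}
variable [NormedAddCommGroup H] [InnerProductSpace ℂ H] [CompleteSpace H]
variable [NormedAddCommGroup H₁] [InnerProductSpace ℂ H₁] [CompleteSpace H₁]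
variable [NormedAddCommGroup H₂] [InnerProductSpace ℂ H₂] [CompleteSpace H₂]
variable [NormedAddCommGroup K] [InnerProductSpace ℂ K] [CompleteSpace K]

/-- Trace class via a real bound. -/
lemma isTraceClass_of_bound {A : H →L[ℂ] H} (C : ℝ)
    (h : ∀ (n : ℕ) (f g : Fin n → H), Orthonormal ℂ f → Orthonormal ℂ g →
      ∑ i, ‖@inner ℂ _ _ (A (f i)) (g i)‖ ≤ C) : IsTraceClass A := by
  unfold IsTraceClass traceNorm
  refine ne_top_of_le_ne_top (ENNReal.ofReal_ne_top (r := C)) ?_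
  refine iSup_le fun n => iSup_le fun f => iSup_le fun g => iSup_le fun hf => iSup_le fun hg => ?_
  have h1 := h n f g hf hg
  calc ∑ i, (‖@inner ℂ _ _ (A (f i)) (g i)‖₊ : ℝ≥0∞)
      = ENNReal.ofReal (∑ i, ‖@inner ℂ _ _ (A (f i)) (g i)‖) := by
        rw [ENNReal.ofReal_sum_of_nonneg (fun _ _ => norm_nonneg _)]
        refine Finset.sum_congr rfl fun i _ => ?_
        rw [ofReal_norm]; rfl
    _ ≤ _ := ENNReal.ofReal_le_ofReal h1

lemma IsTraceClass.bound {A : H →L[ℂ] H} (h : IsTraceClass A) :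
    ∃ C : ℝ, ∀ (n : ℕ) (f g : Fin n → H), Orthonormal ℂ f → Orthonormal ℂ g →
      ∑ i, ‖@inner ℂ _ _ (A (f i)) (g i)‖ ≤ C := by
  refine ⟨(traceNorm A).toReal, fun n f g hf hg => ?_⟩
  have h1 : ENNReal.ofReal (∑ i, ‖@inner ℂ _ _ (A (f i)) (g i)‖) ≤ traceNorm A := by
    have : ENNReal.ofReal (∑ i, ‖@inner ℂ _ _ (A (f i)) (g i)‖)
        = ∑ i, (‖@inner ℂ _ _ (A (f i)) (g i)‖₊ : ℝ≥0∞) := by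
      rw [ENNReal.ofReal_sum_of_nonneg (fun _ _ => norm_nonneg _)]
      refine Finset.sum_congr rfl fun i _ => ?_
      rw [ofReal_norm]; rfl
    rw [this]
    unfold traceNorm
    exact le_iSup_of_le n (le_iSup_of_le f (le_iSup_of_le g (le_iSup_of_le hf
      (le_iSup_of_le hg le_rfl))))
  exact (ENNReal.ofReal_le_iff_le_toReal h).1 h1

lemma IsTraceClass.add {A B : H →L[ℂ] H} (hA : IsTraceClass A) (hB : IsTraceClass B) :
    IsTraceClass (A + B) := by
  obtain ⟨C, hC⟩ := hA.bound
  obtain ⟨C', hC'⟩ := hB.bound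
  refine isTraceClass_of_bound (C + C') fun n f g hf hg => ?_
  refine le_trans ?_ (add_le_add (hC n f g hf hg) (hC' n f g hf hg))
  rw [← Finset.sum_add_distrib]
  refine Finset.sum_le_sum fun i _ => ?_
  rw [_root_.add_apply, inner_add_left]
  exact norm_add_le _ _

lemma IsTraceClass.smul {A : H →L[ℂ] H} (c : ℂ) (hA : IsTraceClass A) :
    IsTraceClass (c • A) := by
  obtain ⟨C, hC⟩ := hA.bound
  refine isTraceClass_of_bound (‖c‖ * C) fun n f g hf hg => ?_
  refine le_trans ?_ (mul_le_mul_of_nonneg_left (hC n f g hf hg) (norm_nonneg c))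
  rw [Finset.mul_sum]
  refine Finset.sum_le_sum fun i _ => ?_
  rw [_root_.smul_apply, inner_smul_left, norm_mul, RCLike.norm_conj]

lemma isTraceClass_zero : IsTraceClass (0 : H →L[ℂ] H) :=
  isTraceClass_of_bound 0 fun n f g _ _ => by simp

/-- Weak Cauchy-Schwarz inequality for positive operators. -/
lemma positive_cs {D : H →L[ℂ] H} (hD : D.IsPositive) (f g : H) :
    2 * ‖@inner ℂ _ _ (D f) g‖ ≤
      (@inner ℂ _ _ (D f) f).re + (@inner ℂ _ _ (D g) g).re := by
  obtain ⟨c, hc, hcz⟩ : ∃ c : ℂ, ‖c‖ = 1 ∧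
      c * @inner ℂ _ _ (D f) g = (‖@inner ℂ _ _ (D f) g‖ : ℂ) := by
    by_cases hz : @inner ℂ _ _ (D f) g = 0
    · exact ⟨1, by simp, by simp [hz]⟩
    · refine ⟨(‖@inner ℂ _ _ (D f) g‖ : ℂ) / @inner ℂ _ _ (D f) g, ?_, ?_⟩
      · rw [norm_div, Complex.norm_real, norm_norm, div_self (norm_ne_zero_iff.2 hz)]
      · field_simp
  have h0 : 0 ≤ (@inner ℂ _ _ (D (f - c • g)) (f - c • g)).re :=
    hD.re_inner_nonneg_left _
  have hsymm : @inner ℂ _ _ (D g) f = (starRingEnd ℂ) (@inner ℂ _ _ (D f) g) := by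
    rw [inner_conj_symm]; exact hD.isSymmetric g f
  have hcc : (starRingEnd ℂ) c * c = 1 := by
    rw [← Complex.normSq_eq_conj_mul_self, Complex.normSq_eq_norm_sq, hc]; simp
  have e : @inner ℂ _ _ (D (f - c • g)) (f - c • g) =
      @inner ℂ _ _ (D f) f + @inner ℂ _ _ (D g) g
        - (c * @inner ℂ _ _ (D f) g + (starRingEnd ℂ) (c * @inner ℂ _ _ (D f) g)) := by
    simp only [map_sub, map_smul, inner_sub_left, inner_sub_right, inner_smul_left,
      inner_smul_right, hsymm, map_mul]
    linear_combination (@inner ℂ _ _ (D g) g) * hcc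
  rw [e, hcz] at h0
  simp at h0
  linarith

/-- The key finite dimensional trace estimate of Berger-Shaw. -/
lemma bs_step (S : H →L[ℂ] H) (E : Submodule ℂ H) [FiniteDimensional ℂ E] (W : Finset H)
    (hE : ∀ x ∈ E, S x ∈ E ⊔ Submodule.span ℂ (W : Set H))
    {n : ℕ} (f : Fin n → H) (hf : Orthonormal ℂ f)
    (hD : Hyponormal S) :
    ∑ i, (@inner ℂ _ _ (cmt (adjoint S) S (E.starProjection (f i)))
      (E.starProjection (f i))).re ≤ W.card * ‖S‖ ^ 2 := by
  set D := cmt (adjoint S) S with hDdef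
  have hDp : D.IsPositive := hD
  -- the compression
  set C : E →ₗ[ℂ] E := (E.orthogonalProjectionOnto : H →ₗ[ℂ] E) ∘ₗ (D : H →ₗ[ℂ] H) ∘ₗ E.subtype
    with hC
  have hCin : ∀ x y : E, @inner ℂ _ _ (C x) y = @inner ℂ _ _ (D (x : H)) (y : H) := by
    intro x y
    simp only [hC, LinearMap.comp_apply]
    exact Submodule.inner_orthogonalProjectionOnto_eq_of_mem_right y _
  have hCs : C.IsSymmetric := by
    intro x y
    rw [hCin, ← inner_conj_symm x, hCin, inner_conj_symm]
    exact hDp.isSymmetric _ _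
  set e := hCs.eigenvectorBasis rfl with he
  set l := hCs.eigenvalues rfl with hl
  have heo : Orthonormal ℂ (fun j => (e j : H)) := e.orthonormal.comp_linearIsometry E.subtypeₗᵢ
  have hlam : ∀ j, l j = ‖S (e j)‖ ^ 2 - ‖adjoint S (e j)‖ ^ 2 := by
    intro j
    have h1 : @inner ℂ _ _ (C (e j)) (e j) = (l j : ℂ) := by
      rw [hCs.apply_eigenvectorBasis rfl j, inner_smul_left, inner_self_eq_norm_sq_to_K,
        e.orthonormal.1 j]
      simp [hl]
    rw [hCin, hDdef] at h1
    simp only [cmt, _root_.sub_apply, mul_apply_eq_comp,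
      inner_sub_left] at h1
    rw [adjoint_inner_left, ← adjoint_inner_right S (adjoint S (e j : H)), inner_self_eq_norm_sq_to_K,
      inner_self_eq_norm_sq_to_K] at h1
    have h2 := congrArg Complex.re h1.symm
    rw [Complex.sub_re, Complex.ofReal_re] at h2
    rw [h2]
    congr 1 <;> norm_cast
  have hlnn : ∀ j, 0 ≤ l j := by
    intro j
    have h1 : @inner ℂ _ _ (C (e j)) (e j) = (l j : ℂ) := by
      rw [hCs.apply_eigenvectorBasis rfl j, inner_smul_left, inner_self_eq_norm_sq_to_K,
        e.orthonormal.1 j]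
      simp [hl]
    have h2 : 0 ≤ (@inner ℂ _ _ (D (e j : H)) (e j : H)).re := hDp.re_inner_nonneg_left _
    rw [← hCin, h1] at h2
    simpa using h2
  -- the range of the off diagonal part
  set G : Submodule ℂ H := (Submodule.span ℂ (W : Set H)).map (Eᗮ.starProjection : H →ₗ[ℂ] H)
    with hG
  have : FiniteDimensional ℂ (Submodule.span ℂ (W : Set H)) :=
    FiniteDimensional.span_finset ℂ W
  have : FiniteDimensional ℂ G := by rw [hG]; infer_instance
  have hGd : Module.finrank ℂ G ≤ W.card :=
    (Submodule.finrank_map_le _ _).trans (finrank_span_finset_le_card W)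
  set g := stdOrthonormalBasis ℂ G with hg
  have hGm : ∀ x ∈ E, Eᗮ.starProjection (S x) ∈ G := by
    intro x hx
    obtain ⟨y, hy, z, hz, hyz⟩ := Submodule.mem_sup.1 (hE x hx)
    rw [← hyz, map_add, Submodule.starProjection_orthogonal_apply_eq_zero hy, zero_add]
    exact Submodule.mem_map_of_mem (f := (Eᗮ.starProjection : H →ₗ[ℂ] H)) hz
  have hGo : ∀ k, Eᗮ.starProjection (g k : H) = g k := by
    intro k
    rw [Submodule.starProjection_eq_self_iff]
    obtain ⟨w, _, hw⟩ := (g k).2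
    rw [← hw]
    exact Submodule.starProjection_apply_mem _ _
  have hoff : ∑ j, ‖Eᗮ.starProjection (S (e j))‖ ^ 2 ≤ W.card * ‖S‖ ^ 2 := by
    have h1 : ∀ j, ‖Eᗮ.starProjection (S (e j))‖ ^ 2 =
        ∑ k, ‖@inner ℂ _ _ (e j : H) (adjoint S (g k))‖ ^ 2 := by
      intro j
      have := g.sum_sq_norm_inner_left ⟨_, hGm (e j) (e j).2⟩
      rw [Submodule.coe_norm] at this
      rw [← this]
      refine Finset.sum_congr rfl fun k _ => ?_
      rw [Submodule.coe_inner, adjoint_inner_right]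
      simp only
      rw [Submodule.inner_starProjection_left_eq_right, hGo]
    simp_rw [h1]
    rw [Finset.sum_comm]
    calc _ ≤ ∑ k : Fin (Module.finrank ℂ G), ‖S‖ ^ 2 := by
          refine Finset.sum_le_sum fun k _ => ?_
          refine (heo.sum_inner_products_le (adjoint S (g k))).trans ?_
          have := (adjoint S).le_opNorm (g k)
          have hn : ‖(g k : H)‖ = 1 := g.orthonormal.1 k
          rw [hn, mul_one, LinearIsometryEquiv.norm_map] at this
          gcongr
      _ ≤ _ := by
          simp only [Finset.sum_const, Finset.card_univ, Fintype.card_fin, nsmul_eq_mul]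
          gcongr
  have hdiag : ∑ j, ‖E.starProjection (S (e j))‖ ^ 2 ≤ ∑ j, ‖adjoint S (e j)‖ ^ 2 := by
    have h1 : ∀ j, ‖E.starProjection (S (e j))‖ ^ 2 =
        ∑ k, ‖@inner ℂ _ _ (e j : H) (adjoint S (e k))‖ ^ 2 := by
      intro j
      have := e.sum_sq_norm_inner_left (E.orthogonalProjectionOnto (S (e j)))
      rw [Submodule.coe_norm] at this
      rw [Submodule.starProjection_apply, ← this]
      refine Finset.sum_congr rfl fun k _ => ?_
      rw [Submodule.inner_orthogonalProjectionOnto_eq_of_mem_right, adjoint_inner_right]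
    simp_rw [h1]
    rw [Finset.sum_comm]
    exact Finset.sum_le_sum fun k _ => heo.sum_inner_products_le (adjoint S (e k))
  have htr : ∑ j, l j ≤ W.card * ‖S‖ ^ 2 := by
    have : ∀ j, l j = ‖E.starProjection (S (e j))‖ ^ 2 + ‖Eᗮ.starProjection (S (e j))‖ ^ 2
        - ‖adjoint S (e j)‖ ^ 2 := by
      intro j
      rw [hlam, Submodule.norm_sq_eq_add_norm_sq_starProjection (S (e j)) E]
    simp_rw [this]
    rw [Finset.sum_sub_distrib, Finset.sum_add_distrib]
    linarith
  refine le_trans ?_ htr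
  have hexp : ∀ i, (@inner ℂ _ _ (D (E.starProjection (f i))) (E.starProjection (f i))).re
      = ∑ j, l j * ‖@inner ℂ _ _ (f i) (e j : H)‖ ^ 2 := by
    intro i
    set x := E.orthogonalProjectionOnto (f i) with hx
    have h1 : @inner ℂ _ _ (D (E.starProjection (f i))) (E.starProjection (f i))
        = @inner ℂ _ _ (C x) x := by rw [hCin]; rfl
    rw [h1, ← e.sum_inner_mul_inner (C x) x, Complex.re_sum]
    refine Finset.sum_congr rfl fun j _ => ?_
    have h2 : @inner ℂ _ _ x (e j) = @inner ℂ _ _ (f i) (e j : H) :=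
      Submodule.inner_orthogonalProjectionOnto_eq_of_mem_right _ _
    rw [hCs x (e j), hCs.apply_eigenvectorBasis rfl j, inner_smul_right,
      ← inner_conj_symm (e j) x]
    rw [← he, ← hl, h2, mul_assoc, RCLike.mul_conj]
    norm_cast
  simp_rw [hexp]
  rw [Finset.sum_comm]
  refine Finset.sum_le_sum fun j _ => ?_
  rw [← Finset.mul_sum]
  have := hf.sum_inner_products_le (s := Finset.univ) (e j : H)
  have hn : ‖(e j : H)‖ = 1 := e.orthonormal.1 j
  rw [hn, one_pow] at this
  exact mul_le_of_le_one_right (hlnn j) this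

/-- Berger-Shaw theorem (weak quantitative form). -/
lemma berger_shaw (S : H →L[ℂ] H) (hS : Hyponormal S) (ξ : Finset H)
    (hd : Dense ((Submodule.span ℂ {x | ∃ v ∈ ξ, ∃ n : ℕ, x = (S ^ n) v} :
      Submodule ℂ H) : Set H)) : IsTraceClass (cmt (adjoint S) S) := by
  classical
  set E : ℕ → Submodule ℂ H := fun N =>
    Submodule.span ℂ {x | ∃ v ∈ ξ, ∃ n ≤ N, x = (S ^ n) v} with hE
  have hfin : ∀ N, FiniteDimensional ℂ (E N) := by
    intro N
    apply FiniteDimensional.span_of_finite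
    have : {x | ∃ v ∈ ξ, ∃ n ≤ N, x = (S ^ n) v} ⊆
        (fun q : H × ℕ => (S ^ q.2) q.1) '' ((ξ ×ˢ Finset.range (N + 1) : Finset (H × ℕ)) : Set _) := by
      rintro x ⟨v, hv, n, hn, rfl⟩
      exact ⟨(v, n), by simp [hv]; omega, rfl⟩
    exact Set.Finite.subset (Set.Finite.image _ (Finset.finite_toSet _)) this
  have hmono : Monotone E := by
    intro a b hab
    refine Submodule.span_mono ?_
    rintro x ⟨v, hv, n, hn, rfl⟩
    exact ⟨v, hv, n, hn.trans hab, rfl⟩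
  have htop : ⊤ ≤ (⨆ N, E N).topologicalClosure := by
    have h1 : Submodule.span ℂ {x | ∃ v ∈ ξ, ∃ n : ℕ, x = (S ^ n) v} ≤ ⨆ N, E N := by
      rw [Submodule.span_le]
      rintro x ⟨v, hv, n, rfl⟩
      exact Submodule.mem_iSup_of_mem n (Submodule.subset_span ⟨v, hv, n, le_rfl, rfl⟩)
    have h2 := (Submodule.dense_iff_topologicalClosure_eq_top).1 hd
    rw [← h2]
    exact Submodule.topologicalClosure_mono h1
  set D := cmt (adjoint S) S with hD
  have hDp : D.IsPositive := hS
  have key : ∀ (n : ℕ) (f : Fin n → H), Orthonormal ℂ f →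
      ∑ i, (@inner ℂ _ _ (D (f i)) (f i)).re ≤ ξ.card * ‖S‖ ^ 2 := by
    intro n f hf
    have hlim : Filter.Tendsto (fun N => ∑ i, (@inner ℂ _ _ (D ((E N).starProjection (f i)))
        ((E N).starProjection (f i))).re) Filter.atTop
        (nhds (∑ i, (@inner ℂ _ _ (D (f i)) (f i)).re)) := by
      refine tendsto_finsetSum _ fun i _ => ?_
      have h1 := Submodule.starProjection_tendsto_self E hmono (f i) htop
      exact (Complex.continuous_re.tendsto _).comp
        (((D.continuous.tendsto _).comp h1).inner h1)
    refine le_of_tendsto' hlim fun N => ?_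
    refine (bs_step S (E N) (ξ.image (fun v => (S ^ (N + 1)) v)) ?_ f hf hS).trans ?_
    · intro x hx
      have : E N ≤ (E N ⊔ Submodule.span ℂ
          ((ξ.image (fun v => (S ^ (N + 1)) v) : Finset H) : Set H)).comap (S : H →ₗ[ℂ] H) := by
        rw [hE]
        simp only
        rw [Submodule.span_le]
        rintro x ⟨v, hv, n, hn, rfl⟩
        rw [SetLike.mem_coe, Submodule.mem_comap, ContinuousLinearMap.coe_coe]
        have h2 : S ((S ^ n) v) = (S ^ (n + 1)) v := by rw [pow_succ']; rfl
        rw [h2]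
        rcases hn.lt_or_eq with h | h
        · exact Submodule.mem_sup_left (Submodule.subset_span ⟨v, hv, n + 1, h, rfl⟩)
        · subst h
          refine Submodule.mem_sup_right (Submodule.subset_span ?_)
          exact_mod_cast Finset.mem_image_of_mem _ hv
      exact this hx
    · refine mul_le_mul_of_nonneg_right ?_ (by positivity)
      exact_mod_cast Finset.card_image_le
  refine isTraceClass_of_bound (ξ.card * ‖S‖ ^ 2) fun n f g hf hg => ?_
  have h1 : ∑ i, 2 * ‖@inner ℂ _ _ (D (f i)) (g i)‖ ≤
      ∑ i, ((@inner ℂ _ _ (D (f i)) (f i)).re + (@inner ℂ _ _ (D (g i)) (g i)).re) :=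
    Finset.sum_le_sum fun i _ => positive_cs hDp _ _
  rw [← Finset.mul_sum, Finset.sum_add_distrib] at h1
  have h2 := key n f hf
  have h3 := key n g hg
  linarith

/-- Span of the words `S^i R^j` with `j < d`. -/
def lowSpan (S R : H →L[ℂ] H) (d : ℕ) : Submodule ℂ (H →L[ℂ] H) :=
  Submodule.span ℂ {X | ∃ i : ℕ, ∃ j < d, X = S ^ i * R ^ j}

lemma lowSpan_mono (S R : H →L[ℂ] H) {a b : ℕ} (h : a ≤ b) : lowSpan S R a ≤ lowSpan S R b := by
  refine Submodule.span_mono ?_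
  rintro X ⟨i, j, hj, rfl⟩
  exact ⟨i, j, hj.trans_le h, rfl⟩

lemma lowSpan_mulS (S R : H →L[ℂ] H) {d : ℕ} {X : H →L[ℂ] H} (hX : X ∈ lowSpan S R d) :
    S * X ∈ lowSpan S R d := by
  have : lowSpan S R d ≤ (lowSpan S R d).comap (LinearMap.mulLeft ℂ S) := by
    conv_lhs => rw [lowSpan]
    rw [Submodule.span_le]
    rintro X ⟨i, j, hj, rfl⟩
    rw [SetLike.mem_coe, Submodule.mem_comap, LinearMap.mulLeft_apply]
    exact Submodule.subset_span ⟨i + 1, j, hj, by rw [pow_succ', mul_assoc]⟩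
  exact this hX

lemma lowSpan_mulSpow (S R : H →L[ℂ] H) {d : ℕ} {X : H →L[ℂ] H} (hX : X ∈ lowSpan S R d)
    (i : ℕ) : S ^ i * X ∈ lowSpan S R d := by
  induction i with
  | zero => simpa using hX
  | succ i ih => rw [pow_succ', mul_assoc]; exact lowSpan_mulS S R ih

lemma lowSpan_mulR (S R : H →L[ℂ] H) (hc : Commute S R) {d : ℕ} {X : H →L[ℂ] H}
    (hX : X ∈ lowSpan S R d) : R * X ∈ lowSpan S R (d + 1) := by
  have : lowSpan S R d ≤ (lowSpan S R (d + 1)).comap (LinearMap.mulLeft ℂ R) := by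
    conv_lhs => rw [lowSpan]
    rw [Submodule.span_le]
    rintro X ⟨i, j, hj, rfl⟩
    rw [SetLike.mem_coe, Submodule.mem_comap, LinearMap.mulLeft_apply]
    refine Submodule.subset_span ⟨i, j + 1, by omega, ?_⟩
    rw [← mul_assoc, ← (hc.pow_left i).eq, mul_assoc, ← pow_succ']
  exact this hX

lemma lowSpan_succ_le (S R : H →L[ℂ] H) {d : ℕ} (h : R ^ d ∈ lowSpan S R d) :
    lowSpan S R (d + 1) ≤ lowSpan S R d := by
  conv_lhs => rw [lowSpan]
  rw [Submodule.span_le]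
  rintro X ⟨i, j, hj, rfl⟩
  rcases (Nat.lt_succ_iff.1 hj).lt_or_eq with h' | h'
  · exact Submodule.subset_span ⟨i, j, h', rfl⟩
  · subst h'; exact lowSpan_mulSpow S R h i

lemma lead_step (S R : H →L[ℂ] H) (hc : Commute S R) (u w c : ℂ) {d : ℕ} {X : H →L[ℂ] H}
    (hX : X - c • R ^ d ∈ lowSpan S R d) :
    (u • R + w • S) * X - (u * c) • R ^ (d + 1) ∈ lowSpan S R (d + 1) := by
  have e : (u • R + w • S) * X - (u * c) • R ^ (d + 1) =
      u • (R * (X - c • R ^ d)) + w • (S * (X - c • R ^ d)) + (w * c) • (S ^ 1 * R ^ d) := by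
    simp only [add_mul, mul_sub, smul_mul_assoc, mul_smul_comm, smul_sub, smul_smul, pow_succ' R d,
      pow_one]
    abel
  rw [e]
  refine Submodule.add_mem _ (Submodule.add_mem _ ?_ ?_) ?_
  · exact Submodule.smul_mem _ _ (lowSpan_mulR S R hc hX)
  · exact Submodule.smul_mem _ _ (lowSpan_mono S R (Nat.le_succ d) (lowSpan_mulS S R hX))
  · exact Submodule.smul_mem _ _ (Submodule.subset_span ⟨1, d, Nat.lt_succ_self d, rfl⟩)

lemma lead_pow (S R : H →L[ℂ] H) (hc : Commute S R) (u w c : ℂ) {d : ℕ} {X : H →L[ℂ] H}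
    (hX : X - c • R ^ d ∈ lowSpan S R d) (a : ℕ) :
    (u • R + w • S) ^ a * X - (u ^ a * c) • R ^ (a + d) ∈ lowSpan S R (a + d) := by
  induction a with
  | zero => simpa using hX
  | succ a ih =>
    have := lead_step S R hc u w _ ih
    rw [pow_succ' (u • R + w • S), mul_assoc, pow_succ' u, mul_assoc,
      show a + 1 + d = a + d + 1 by omega]
    exact this

lemma opWord_two (T : Fin 2 → H →L[ℂ] H) (n : Fin 2 → ℕ) :
    opWord T n = T 0 ^ n 0 * T 1 ^ n 1 := by
  simp [opWord, List.ofFn_succ]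

lemma opWord_lead (T : Fin 2 → H →L[ℂ] H) (S R : H →L[ℂ] H) (hc : Commute S R) (u w : Fin 2 → ℂ)
    (hT : ∀ i, T i = u i • R + w i • S) (n : Fin 2 → ℕ) :
    opWord T n - (u 0 ^ n 0 * u 1 ^ n 1) • R ^ (n 0 + n 1) ∈ lowSpan S R (n 0 + n 1) := by
  rw [opWord_two, hT 0, hT 1]
  have h0 : (1 : H →L[ℂ] H) - (1 : ℂ) • R ^ 0 ∈ lowSpan S R 0 := by simp
  have h1 := lead_pow S R hc (u 1) (w 1) 1 h0 (n 1)
  rw [mul_one, mul_one, add_zero] at h1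
  exact lead_pow S R hc (u 0) (w 0) _ h1 (n 0)

lemma opWord_mem (T : Fin 2 → H →L[ℂ] H) (S R : H →L[ℂ] H) (hc : Commute S R) (u w : Fin 2 → ℂ)
    (hT : ∀ i, T i = u i • R + w i • S) {k : ℕ} (hR : R ^ k ∈ lowSpan S R k) (n : Fin 2 → ℕ) :
    opWord T n ∈ lowSpan S R k := by
  have hR' : ∀ X ∈ lowSpan S R k, R * X ∈ lowSpan S R k := fun X hX =>
    lowSpan_succ_le S R hR (lowSpan_mulR S R hc hX)
  have hT' : ∀ i, ∀ X ∈ lowSpan S R k, T i * X ∈ lowSpan S R k := by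
    intro i X hX
    rw [hT i, add_mul, smul_mul_assoc, smul_mul_assoc]
    exact Submodule.add_mem _ (Submodule.smul_mem _ _ (hR' X hX))
      (Submodule.smul_mem _ _ (lowSpan_mulS S R hX))
  have hTp : ∀ i (a : ℕ), ∀ X ∈ lowSpan S R k, T i ^ a * X ∈ lowSpan S R k := by
    intro i a X hX
    induction a with
    | zero => simpa using hX
    | succ a ih => rw [pow_succ', mul_assoc]; exact hT' i _ ih
  have h1 : (1 : H →L[ℂ] H) ∈ lowSpan S R k := by
    rcases Nat.eq_zero_or_pos k with h | h
    · subst h; simpa using hR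
    · exact Submodule.subset_span ⟨0, 0, h, by simp⟩
  rw [opWord_two]
  have := hTp 0 (n 0) _ (hTp 1 (n 1) _ h1)
  simpa using this

/-- A nonvanishing leading form gives an integral dependence relation. -/
lemma lead_relation (T : Fin 2 → H →L[ℂ] H) (S R : H →L[ℂ] H) (hc : Commute S R)
    (u w : Fin 2 → ℂ) (hT : ∀ i, T i = u i • R + w i • S)
    (p : MvPolynomial (Fin 2) ℂ) (hpT : evalPoly T p = 0)
    (hu : MvPolynomial.eval u (MvPolynomial.homogeneousComponent p.totalDegree p) ≠ 0) :
    R ^ p.totalDegree ∈ lowSpan S R p.totalDegree := by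
  set k := p.totalDegree with hk
  set c := MvPolynomial.eval u (MvPolynomial.homogeneousComponent k p) with hcdef
  have hdeg : ∀ mo : Fin 2 →₀ ℕ, mo.degree = mo 0 + mo 1 := by
    intro mo
    rw [Finsupp.degree_eq_sum, Fin.sum_univ_two]
  have hle : ∀ mo ∈ p.support, mo 0 + mo 1 ≤ k := by
    intro mo hmo
    have := MvPolynomial.le_totalDegree hmo
    rw [← hdeg]
    exact this
  have hceq : c = ∑ mo ∈ p.support,
      if mo 0 + mo 1 = k then MvPolynomial.coeff mo p * (u 0 ^ mo 0 * u 1 ^ mo 1) else 0 := by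
    rw [hcdef, MvPolynomial.homogeneousComponent_apply, map_sum, Finset.sum_filter]
    refine Finset.sum_congr rfl fun mo _ => ?_
    rw [hdeg]
    split_ifs
    · rw [MvPolynomial.eval_monomial, Finsupp.prod_fintype _ _ (by simp), Fin.prod_univ_two]
    · rfl
  have hmem : evalPoly T p - c • R ^ k ∈ lowSpan S R k := by
    rw [evalPoly, hceq, Finset.sum_smul, ← Finset.sum_sub_distrib]
    refine Submodule.sum_mem _ fun mo hmo => ?_
    have h1 := opWord_lead T S R hc u w hT (fun i => mo i)
    split_ifs with h
    · rw [mul_smul, ← smul_sub]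
      rw [h] at h1
      exact Submodule.smul_mem _ _ h1
    · rw [zero_smul, sub_zero]
      refine Submodule.smul_mem _ _ ?_
      have hlt : mo 0 + mo 1 < k := lt_of_le_of_ne (hle mo hmo) h
      have h2 : (u 0 ^ mo 0 * u 1 ^ mo 1) • R ^ (mo 0 + mo 1) ∈ lowSpan S R k :=
        Submodule.smul_mem _ _ (Submodule.subset_span ⟨0, _, hlt, by simp⟩)
      have h3 := Submodule.add_mem _ (lowSpan_mono S R hlt.le h1) h2
      simpa using h3
  rw [hpT, zero_sub, Submodule.neg_mem_iff] at hmem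
  have := Submodule.smul_mem _ c⁻¹ hmem
  rwa [smul_smul, inv_mul_cancel₀ hu, one_smul] at this

/-- The combination `u 1 • T 0 - u 0 • T 1`. -/
def dirOp (T : Fin 2 → H →L[ℂ] H) (u : Fin 2 → ℂ) : H →L[ℂ] H := u 1 • T 0 - u 0 • T 1

lemma dirOp_hyponormal (T : Fin 2 → H →L[ℂ] H) (hph : ProjHyponormal T) (u : Fin 2 → ℂ) :
    Hyponormal (dirOp T u) := by
  have := hph ![u 1, - u 0]
  rw [Fin.sum_univ_two] at this
  simpa [dirOp, sub_eq_add_neg] using this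

lemma good_dir (T : Fin 2 → H →L[ℂ] H) (hcomm : ∀ i j, Commute (T i) (T j))
    (hph : ProjHyponormal T) (m : ℕ) (hcyc : IsPolyCyclicTuple T m)
    (p : MvPolynomial (Fin 2) ℂ) (hpT : evalPoly T p = 0) (u : Fin 2 → ℂ)
    (hu : MvPolynomial.eval u (MvPolynomial.homogeneousComponent p.totalDegree p) ≠ 0) :
    IsTraceClass (cmt (adjoint (dirOp T u)) (dirOp T u)) := by
  classical
  by_cases hu0 : u 0 = 0 ∧ u 1 = 0
  · have : dirOp T u = 0 := by simp [dirOp, hu0.1, hu0.2]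
    rw [this]
    simpa [cmt] using isTraceClass_zero
  obtain ⟨v0, v1, hv⟩ : ∃ v0 v1 : ℂ, u 0 * v0 + u 1 * v1 = 1 := by
    by_cases h : u 0 = 0
    · have h1 : u 1 ≠ 0 := fun h1 => hu0 ⟨h, h1⟩
      exact ⟨0, (u 1)⁻¹, by simp [h1]⟩
    · exact ⟨(u 0)⁻¹, 0, by simp [h]⟩
  set S := dirOp T u with hS
  set R := v0 • T 0 + v1 • T 1 with hR
  have hc : Commute S R := by
    rw [hS, hR, dirOp]
    have h (i j) (a b : ℂ) : Commute (a • T i) (b • T j) :=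
      ((hcomm i j).smul_left a).smul_right b
    exact ((h _ _ _ _).add_right (h _ _ _ _)).sub_left ((h _ _ _ _).add_right (h _ _ _ _))
  have hT : ∀ i, T i = u i • R + (![v1, -v0] : Fin 2 → ℂ) i • S := by
    have h0 : T 0 = u 0 • R + v1 • S := by
      rw [hR, hS, dirOp]
      calc T 0 = (u 0 * v0 + u 1 * v1) • T 0 := by rw [hv, one_smul]
        _ = _ := by module
    have h1 : T 1 = u 1 • R + (-v0) • S := by
      rw [hR, hS, dirOp]
      calc T 1 = (u 0 * v0 + u 1 * v1) • T 1 := by rw [hv, one_smul]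
        _ = _ := by module
    intro i
    fin_cases i
    · exact h0
    · exact h1
  set k := p.totalDegree with hk
  have hRk : R ^ k ∈ lowSpan S R k := lead_relation T S R hc u _ hT p hpT hu
  obtain ⟨ξ, -, hd⟩ := hcyc.1
  refine berger_shaw S (dirOp_hyponormal T hph u)
    ((ξ ×ˢ Finset.range k).image (fun q : H × ℕ => (R ^ q.2) q.1)) ?_
  refine hd.mono ?_
  rw [SetLike.coe_subset_coe, Submodule.span_le]
  rintro x ⟨v, hv, n, rfl⟩
  have h1 := opWord_mem T S R hc u _ hT hRk n
  set M := Submodule.span ℂ {x | ∃ v ∈ (ξ ×ˢ Finset.range k).image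
    (fun q : H × ℕ => (R ^ q.2) q.1), ∃ n : ℕ, x = (S ^ n) v} with hM
  have h2 : lowSpan S R k ≤ M.comap (ContinuousLinearMap.apply ℂ H v : (H →L[ℂ] H) →ₗ[ℂ] H) := by
    conv_lhs => rw [lowSpan]
    rw [Submodule.span_le]
    rintro X ⟨i, j, hj, rfl⟩
    rw [SetLike.mem_coe, Submodule.mem_comap]
    refine Submodule.subset_span ⟨(R ^ j) v, ?_, i, rfl⟩
    exact Finset.mem_image.2 ⟨(v, j), by simp [hv, hj], rfl⟩
  exact h2 h1

lemma all_dir (T : Fin 2 → H →L[ℂ] H) (hcomm : ∀ i j, Commute (T i) (T j))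
    (hph : ProjHyponormal T) (m : ℕ) (hcyc : IsPolyCyclicTuple T m)
    (p : MvPolynomial (Fin 2) ℂ) (hp : p ≠ 0) (hpT : evalPoly T p = 0) (x : Fin 2 → ℂ) :
    IsTraceClass (cmt (adjoint (dirOp T x)) (dirOp T x)) := by
  set q := MvPolynomial.homogeneousComponent p.totalDegree p with hq
  have hq0 : q ≠ 0 := by
    obtain ⟨mo, hmo, hdeg⟩ := Finset.exists_mem_eq_sup p.support
      (MvPolynomial.support_nonempty.2 hp) (fun s : Fin 2 →₀ ℕ => s.degree)
    intro h
    have h1 : MvPolynomial.coeff mo q = 0 := by rw [h]; simp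
    have h2 : mo.degree = p.totalDegree := hdeg.symm
    rw [hq, MvPolynomial.coeff_homogeneousComponent, if_pos h2] at h1
    exact (MvPolynomial.mem_support_iff.1 hmo) h1
  obtain ⟨u, hu⟩ : ∃ u, MvPolynomial.eval u q ≠ 0 := by
    by_contra! h
    exact hq0 (MvPolynomial.funext fun u => by simpa using h u)
  have hcont : Continuous (fun u : Fin 2 → ℂ => MvPolynomial.eval u q) :=
    MvPolynomial.continuous_eval q
  obtain ⟨ε, hε0, h1, h2⟩ : ∃ ε : ℝ, ε ≠ 0 ∧ MvPolynomial.eval (u + (ε : ℂ) • x) q ≠ 0 ∧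
      MvPolynomial.eval (u - (ε : ℂ) • x) q ≠ 0 := by
    have ha : ∀ᶠ ε : ℝ in nhds 0, MvPolynomial.eval (u + (ε : ℂ) • x) q ≠ 0 := by
      have : Continuous (fun ε : ℝ => MvPolynomial.eval (u + (ε : ℂ) • x) q) :=
        hcont.comp (by fun_prop)
      exact this.continuousAt.eventually_ne (by simpa using hu)
    have hb : ∀ᶠ ε : ℝ in nhds 0, MvPolynomial.eval (u - (ε : ℂ) • x) q ≠ 0 := by
      have : Continuous (fun ε : ℝ => MvPolynomial.eval (u - (ε : ℂ) • x) q) :=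
        hcont.comp (by fun_prop)
      exact this.continuousAt.eventually_ne (by simpa using hu)
    have hc : ∀ᶠ ε : ℝ in nhdsWithin 0 {0}ᶜ, ε ∈ ({0}ᶜ : Set ℝ) := self_mem_nhdsWithin
    obtain ⟨ε, ⟨h1, h2⟩, h3⟩ :=
      (((ha.and hb).filter_mono nhdsWithin_le_nhds).and hc).exists
    exact ⟨ε, h3, h1, h2⟩
  have g0 := good_dir T hcomm hph m hcyc p hpT u hu
  have g1 := good_dir T hcomm hph m hcyc p hpT _ h1
  have g2 := good_dir T hcomm hph m hcyc p hpT _ h2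
  have e1 : dirOp T (u + (ε : ℂ) • x) = dirOp T u + (ε : ℂ) • dirOp T x := by
    simp only [dirOp, Pi.add_apply, Pi.smul_apply, smul_eq_mul]; module
  have e2 : dirOp T (u - (ε : ℂ) • x) = dirOp T u - (ε : ℂ) • dirOp T x := by
    simp only [dirOp, Pi.sub_apply, Pi.smul_apply, smul_eq_mul]; module
  rw [e1] at g1
  rw [e2] at g2
  set A := dirOp T u
  set B := dirOp T x
  have key : cmt (adjoint B) B = ((ε : ℂ) ^ 2)⁻¹ • ((1 / 2 : ℂ) •
      (cmt (adjoint (A + (ε : ℂ) • B)) (A + (ε : ℂ) • B)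
        + cmt (adjoint (A - (ε : ℂ) • B)) (A - (ε : ℂ) • B)) + (-1 : ℂ) • cmt (adjoint A) A) := by
    have hε : (ε : ℂ) ^ 2 ≠ 0 := pow_ne_zero _ (by exact_mod_cast hε0)
    rw [eq_inv_smul_iff₀ hε]
    simp only [cmt, map_add, map_sub, map_smulₛₗ, Complex.conj_ofReal, add_mul, mul_add, sub_mul,
      mul_sub, smul_mul_assoc, mul_smul_comm]
    module
  rw [key]
  exact (((g1.add g2).smul _).add (g0.smul _)).smul _

/-- a projectively hyponormal, pure, `m`-polynomially cyclic commuting pair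
annihilated by a nonzero polynomial has trace class commutators. -/
theorem statement_9 [TopologicalSpace.SeparableSpace H]
    (T : Fin 2 → H →L[ℂ] H) (hcomm : ∀ i j, Commute (T i) (T j))
    (hph : ProjHyponormal T) (hpure : ∀ i, IsPureHyponormal (T i))
    (m : ℕ) (hcyc : IsPolyCyclicTuple T m)
    (p : MvPolynomial (Fin 2) ℂ) (hp : p ≠ 0) (hpT : evalPoly T p = 0) :
    ∀ i j, IsTraceClass (cmt (adjoint (T j)) (T i)) := by
  have all := all_dir T hcomm hph m hcyc p hp hpT
  have hlin : ∀ a b : ℂ, IsTraceClass (cmt (adjoint (a • T 0 + b • T 1)) (a • T 0 + b • T 1)) := by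
    intro a b
    have := all ![-b, a]
    simpa [dirOp] using this
  have hpol : ∀ i j : Fin 2, ∀ ω : ℂ,
      IsTraceClass (cmt (adjoint (T i + ω • T j)) (T i + ω • T j)) := by
    intro i j ω
    have h00 := hlin (1 + ω) 0
    have h01 := hlin 1 ω
    have h10 := hlin ω 1
    have h11 := hlin 0 (1 + ω)
    rw [add_smul, one_smul, zero_smul, add_zero] at h00
    rw [one_smul] at h01
    rw [one_smul, add_comm] at h10
    rw [add_smul, one_smul, zero_smul, zero_add] at h11
    fin_cases i <;> fin_cases j
    · exact h00
    · exact h01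
    · exact h10
    · exact h11
  intro i j
  have key : cmt (adjoint (T j)) (T i) = (1 / 4 : ℂ) •
      ((cmt (adjoint (T i + (1 : ℂ) • T j)) (T i + (1 : ℂ) • T j)
        + (-1 : ℂ) • cmt (adjoint (T i + (-1 : ℂ) • T j)) (T i + (-1 : ℂ) • T j))
      + (Complex.I • cmt (adjoint (T i + Complex.I • T j)) (T i + Complex.I • T j)
        + (-Complex.I) • cmt (adjoint (T i + (-Complex.I) • T j)) (T i + (-Complex.I) • T j))) := by
    simp only [cmt, map_add, map_smulₛₗ, map_neg, map_one, Complex.conj_I, add_mul, mul_add,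
      smul_mul_assoc, mul_smul_comm, smul_sub, smul_add, smul_smul, neg_mul, mul_neg,
      Complex.I_mul_I, neg_neg, mul_one, one_mul]
    module
  rw [key]
  exact (((hpol i j 1).add ((hpol i j (-1)).smul _)).add
    (((hpol i j Complex.I).smul _).add ((hpol i j (-Complex.I)).smul _))).smul _
end
end

section
/- For any commuting d-tuple T = (T_1, …, T_d) of bounded operators on a complex Hilbert space, the determinant operator equals the generalized commutator: dEt([[T*, T]]) = GC(T*, T), i.e. Σ_{σ,τ ∈ S_d} sgn(σ) [T*_{τ(1)}, T_{σ(τ(1))}][T*_{τ(2)}, T_{σ(τ(2))}]···[T*_{τ(d)}, T_{σ(τ(d))}] = S_{2d}(T_1*, T_1, T_2*, T_2, …, T_d*, T_d). -/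
open ContinuousLinearMap MeasureTheory
open scoped ENNReal NNReal ComplexOrder

noncomputable section

variable {H H₁ H₂ K : Type*}
variable [NormedAddCommGroup H] [InnerProductSpace ℂ H] [CompleteSpace H]
variable [NormedAddCommGroup H₁] [InnerProductSpace ℂ H₁] [CompleteSpace H₁]
variable [NormedAddCommGroup H₂] [InnerProductSpace ℂ H₂] [CompleteSpace H₂]
variable [NormedAddCommGroup K] [InnerProductSpace ℂ K] [CompleteSpace K]

/-- The permutation of `Fin d × Fin 2` built from permutations in each colour and pair flips. -/
def gcPerm {d : ℕ} (x : (Fin 2 → Equiv.Perm (Fin d)) × (Fin d → Equiv.Perm (Fin 2))) :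
    Equiv.Perm (Fin d × Fin 2) :=
  Equiv.prodCongrLeft x.1 * Equiv.prodCongrRight x.2

theorem gcPerm_apply {d : ℕ} (x : (Fin 2 → Equiv.Perm (Fin d)) × (Fin d → Equiv.Perm (Fin 2)))
    (k : Fin d) (b : Fin 2) : gcPerm x (k, b) = (x.1 (x.2 k b) k, x.2 k b) := rfl

theorem gcPerm_injective {d : ℕ} : Function.Injective (gcPerm (d := d)) := by
  intro x y h
  have h' : ∀ k b, gcPerm x (k, b) = gcPerm y (k, b) := fun k b => by rw [h]
  simp only [gcPerm_apply, Prod.mk.injEq] at h'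
  have h2 : x.2 = y.2 := by
    funext k
    ext b
    exact congrArg Fin.val (h' k b).2
  refine Prod.ext ?_ h2
  funext b
  ext k
  have := (h' k ((x.2 k).symm b)).1
  rw [← h2] at this
  simp only [Equiv.apply_symm_apply] at this
  exact congrArg Fin.val this

theorem gcPerm_surj {d : ℕ} (σ : Equiv.Perm (Fin d × Fin 2))
    (hσ : ∀ k, (σ (k, 0)).2 ≠ (σ (k, 1)).2) : ∃ x, gcPerm x = σ := by
  have hinj : ∀ k, Function.Injective (fun b => (σ (k, b)).2) := by
    intro k a b hab
    have h1 := hσ k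
    have h2 := h1.symm
    fin_cases a <;> fin_cases b
    · rfl
    · exact absurd hab h1
    · exact absurd hab h2
    · rfl
  let ε : Fin d → Equiv.Perm (Fin 2) := fun k =>
    Equiv.ofBijective _ (Finite.injective_iff_bijective.1 (hinj k))
  have hε : ∀ k b, ε k b = (σ (k, b)).2 := fun k b => rfl
  have hpinj : ∀ b, Function.Injective (fun k => (σ (k, (ε k).symm b)).1) := by
    intro b k k' h
    have h2 : σ (k, (ε k).symm b) = σ (k', (ε k').symm b) := by
      refine Prod.ext h ?_
      rw [← hε, ← hε]
      simp
    exact congrArg Prod.fst (σ.injective h2)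
  let p : Fin 2 → Equiv.Perm (Fin d) := fun b =>
    Equiv.ofBijective _ (Finite.injective_iff_bijective.1 (hpinj b))
  have hp : ∀ b k, p b k = (σ (k, (ε k).symm b)).1 := fun b k => rfl
  refine ⟨(p, ε), ?_⟩
  refine Equiv.ext ?_
  rintro ⟨k, b⟩
  rw [gcPerm_apply]
  simp only [hp, Equiv.symm_apply_apply]
  rw [hε]

theorem gcPerm_good {d : ℕ} (x : (Fin 2 → Equiv.Perm (Fin d)) × (Fin d → Equiv.Perm (Fin 2)))
    (k : Fin d) : (gcPerm x (k, 0)).2 ≠ (gcPerm x (k, 1)).2 := by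
  simp [gcPerm_apply]

theorem gcPerm_sign {d : ℕ} (x : (Fin 2 → Equiv.Perm (Fin d)) × (Fin d → Equiv.Perm (Fin 2))) :
    Equiv.Perm.sign (gcPerm x) =
      (Equiv.Perm.sign (x.1 0) * Equiv.Perm.sign (x.1 1)) * ∏ k, Equiv.Perm.sign (x.2 k) := by
  rw [gcPerm, Equiv.Perm.sign_mul, Equiv.Perm.sign_prodCongrLeft, Equiv.Perm.sign_prodCongrRight,
    Fin.prod_univ_two]

/-- Terms in which some pair carries two letters of the same colour cancel. -/
theorem gc_bad_sum {R : Type*} [Ring R] {d : ℕ} (A : Fin d × Fin 2 → R)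
    (hA : ∀ x y, x.2 = y.2 → A x * A y = A y * A x) :
    ∑ σ : Equiv.Perm (Fin d × Fin 2) with ¬ ∀ k, (σ (k, 0)).2 ≠ (σ (k, 1)).2,
      ((Equiv.Perm.sign σ : ℤ) • (List.ofFn fun k => A (σ (k, 0)) * A (σ (k, 1))).prod) = 0 := by
  classical
  let P : Equiv.Perm (Fin d × Fin 2) → Fin d → Prop := fun σ k => (σ (k, 0)).2 = (σ (k, 1)).2
  have hmem : ∀ σ : Equiv.Perm (Fin d × Fin 2),
      (¬ ∀ k, (σ (k, 0)).2 ≠ (σ (k, 1)).2) ↔ ∃ k, P σ k := by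
    intro σ
    simp [P]
  have hsw0 : ∀ k : Fin d, Equiv.swap ((k, 0) : Fin d × Fin 2) (k, 1) (k, 0) = (k, 1) :=
    fun k => Equiv.swap_apply_left _ _
  have hsw1 : ∀ k : Fin d, Equiv.swap ((k, 0) : Fin d × Fin 2) (k, 1) (k, 1) = (k, 0) :=
    fun k => Equiv.swap_apply_right _ _
  have hsw : ∀ (k j : Fin d) (b : Fin 2), j ≠ k →
      Equiv.swap ((k, 0) : Fin d × Fin 2) (k, 1) (j, b) = (j, b) := fun k j b h =>
    Equiv.swap_apply_of_ne_of_ne (fun h' => h (congrArg Prod.fst h'))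
      (fun h' => h (congrArg Prod.fst h'))
  have hinv : ∀ (σ : Equiv.Perm (Fin d × Fin 2)) (k : Fin d),
      P (σ * Equiv.swap (k, 0) (k, 1)) = P σ := by
    intro σ k
    funext j
    by_cases hj : j = k
    · subst hj
      simp only [P, Equiv.Perm.mul_apply, hsw0, hsw1, eq_iff_iff]
      exact eq_comm
    · simp only [P, Equiv.Perm.mul_apply, hsw k j _ hj]
  let c : ∀ Q : Fin d → Prop, (∃ k, Q k) → Fin d := fun Q h => Classical.choose h
  have hc : ∀ (Q : Fin d → Prop) (h : ∃ k, Q k), Q (c Q h) := fun Q h => Classical.choose_spec h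
  have hcc : ∀ (Q Q' : Fin d → Prop) (h : ∃ k, Q k) (h' : ∃ k, Q' k), Q = Q' → c Q h = c Q' h' := by
    intro Q Q' h h' e
    subst e
    rfl
  refine Finset.sum_involution
    (fun σ h => σ * Equiv.swap (c (P σ) ((hmem σ).1 (Finset.mem_filter.1 h).2), 0)
      (c (P σ) ((hmem σ).1 (Finset.mem_filter.1 h).2), 1)) ?_ ?_ ?_ ?_
  · intro σ h
    have hk := hc (P σ) ((hmem σ).1 (Finset.mem_filter.1 h).2)
    generalize c (P σ) ((hmem σ).1 (Finset.mem_filter.1 h).2) = k at hk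
    have hne : ((k, 0) : Fin d × Fin 2) ≠ (k, 1) := by simp
    have hfun : (fun j => A ((σ * Equiv.swap (k, 0) (k, 1) : Equiv.Perm (Fin d × Fin 2)) (j, 0)) *
        A ((σ * Equiv.swap (k, 0) (k, 1) : Equiv.Perm (Fin d × Fin 2)) (j, 1))) = fun j => A (σ (j, 0)) * A (σ (j, 1)) := by
      funext j
      by_cases hj : j = k
      · subst hj
        simp only [Equiv.Perm.mul_apply, hsw0, hsw1]
        exact hA _ _ hk.symm
      · simp only [Equiv.Perm.mul_apply, hsw k j _ hj]
    simp only [hfun, Equiv.Perm.sign_mul, Equiv.Perm.sign_swap hne]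
    simp
  · intro σ h _ heq
    have h1 := mul_eq_left.1 heq
    have := Equiv.swap_eq_one_iff.1 h1
    simp at this
  · intro σ h
    refine Finset.mem_filter.2 ⟨Finset.mem_univ _, ?_⟩
    rw [hmem, hinv]
    exact (hmem σ).1 (Finset.mem_filter.1 h).2
  · intro σ h
    rw [hcc (P (σ * _)) (P σ) _ ((hmem σ).1 (Finset.mem_filter.1 h).2) (hinv _ _), mul_assoc,
      Equiv.swap_mul_self, mul_one]

theorem gc_ofFn_sum {R ι : Type*} [Ring R] [Fintype ι] [DecidableEq ι] {d : ℕ}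
    (f : Fin d → ι → R) :
    (List.ofFn fun k => ∑ i, f k i).prod = ∑ ε : Fin d → ι, (List.ofFn fun k => f k (ε k)).prod := by
  have := (MultilinearMap.mkPiAlgebraFin ℤ d R).map_sum f
  simpa [MultilinearMap.mkPiAlgebraFin_apply] using this

theorem gc_ofFn_smul {R : Type*} [Ring R] {d : ℕ} (c : Fin d → ℤ) (f : Fin d → R) :
    (List.ofFn fun k => c k • f k).prod = (∏ k, c k) • (List.ofFn f).prod := by
  have := (MultilinearMap.mkPiAlgebraFin ℤ d R).map_smul_univ c f
  simpa [MultilinearMap.mkPiAlgebraFin_apply] using this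

theorem gc_flip_sum {R : Type*} [Ring R] (g : Fin 2 → R) :
    ∑ e : Equiv.Perm (Fin 2), (Equiv.Perm.sign e : ℤ) • (g (e 0) * g (e 1)) =
      g 0 * g 1 - g 1 * g 0 := by
  have hu : (Finset.univ : Finset (Equiv.Perm (Fin 2))) = {1, Equiv.swap 0 1} := by decide
  have hne : (1 : Equiv.Perm (Fin 2)) ≠ Equiv.swap 0 1 := by decide
  rw [hu, Finset.sum_pair hne]
  simp [sub_eq_add_neg]

/-- The core identity, for words indexed by `Fin d × Fin 2`. -/
theorem gc_core {R : Type*} [Ring R] {d : ℕ} (A : Fin d × Fin 2 → R)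
    (hA : ∀ x y, x.2 = y.2 → A x * A y = A y * A x) :
    ∑ σ : Equiv.Perm (Fin d × Fin 2),
      ((Equiv.Perm.sign σ : ℤ) • (List.ofFn fun k => A (σ (k, 0)) * A (σ (k, 1))).prod) =
    ∑ p : Fin 2 → Equiv.Perm (Fin d),
      ((Equiv.Perm.sign (p 0) * Equiv.Perm.sign (p 1) : ℤˣ) : ℤ) •
        (List.ofFn fun k => A (p 0 k, 0) * A (p 1 k, 1) - A (p 1 k, 1) * A (p 0 k, 0)).prod := by
  classical
  rw [← Finset.sum_filter_add_sum_filter_not Finset.univ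
    (fun σ : Equiv.Perm (Fin d × Fin 2) => ∀ k, (σ (k, 0)).2 ≠ (σ (k, 1)).2), gc_bad_sum A hA,
    add_zero]
  have himg : (Finset.univ.filter
      (fun σ : Equiv.Perm (Fin d × Fin 2) => ∀ k, (σ (k, 0)).2 ≠ (σ (k, 1)).2)) =
      Finset.univ.image (gcPerm (d := d)) := by
    ext σ
    simp only [Finset.mem_filter, Finset.mem_univ, true_and, Finset.mem_image]
    refine ⟨gcPerm_surj σ, ?_⟩
    rintro ⟨x, rfl⟩ k
    exact gcPerm_good x k
  rw [himg, Finset.sum_image (fun x _ y _ h => gcPerm_injective h), Fintype.sum_prod_type]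
  refine Finset.sum_congr rfl fun p _ => ?_
  have h1 : (fun k => A (p 0 k, 0) * A (p 1 k, 1) - A (p 1 k, 1) * A (p 0 k, 0)) =
      fun k => ∑ e : Equiv.Perm (Fin 2), (Equiv.Perm.sign e : ℤ) •
        (A (p (e 0) k, e 0) * A (p (e 1) k, e 1)) := by
    funext k
    exact (gc_flip_sum (fun b => A (p b k, b))).symm
  rw [h1, gc_ofFn_sum, Finset.smul_sum]
  refine Finset.sum_congr rfl fun ε _ => ?_
  rw [gc_ofFn_smul (fun k => (Equiv.Perm.sign (ε k) : ℤ))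
    (fun k => A (p (ε k 0) k, ε k 0) * A (p (ε k 1) k, ε k 1)), gcPerm_sign, smul_smul]
  simp [gcPerm_apply]

/-- The reindexing of the `2d` letters by pairs. -/
def gcEquiv (d : ℕ) : Fin d × Fin 2 ≃ Fin (2 * d) :=
  finProdFinEquiv.trans (finCongr (mul_comm d 2))

theorem gcEquiv_val {d : ℕ} (k : Fin d) (b : Fin 2) :
    ((gcEquiv d (k, b) : Fin (2 * d)) : ℕ) = 2 * k + b := by
  simp [gcEquiv, add_comm]

theorem gc_stdPoly {d : ℕ} (B : Fin (2 * d) → H →L[ℂ] H) :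
    stdPoly B = ∑ σ : Equiv.Perm (Fin d × Fin 2), ((Equiv.Perm.sign σ : ℤ) •
      (List.ofFn fun k => B (gcEquiv d (σ (k, 0))) * B (gcEquiv d (σ (k, 1)))).prod) := by
  rw [stdPoly]
  refine (Fintype.sum_equiv (gcEquiv d).permCongr _ _ fun σ => ?_).symm
  rw [Equiv.Perm.sign_permCongr, List.ofFn_mul', List.prod_flatten, List.map_ofFn]
  congr 3
  funext k
  have e : ∀ (b : Fin 2) (h : 2 * (k : ℕ) + b < 2 * d),
      (⟨2 * (k : ℕ) + b, h⟩ : Fin (2 * d)) = gcEquiv d (k, b) := fun b h =>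
    Fin.ext (gcEquiv_val k b).symm
  simp only [Function.comp, e, Equiv.permCongr_apply, Equiv.symm_apply_apply]
  simp [List.ofFn_succ]

/-- for a commuting `d`-tuple, the determinant of the block operator of
commutators equals the Helton-Howe generalized commutator `S_{2d}(T₁*, T₁, …, T_d*, T_d)`. -/
theorem statement_12 {d : ℕ} (T : Fin d → H →L[ℂ] H)
    (hcomm : ∀ i j, Commute (T i) (T j)) :
    detOp T = genComm T := by
  have hcs : ∀ i j, Commute (adjoint (T i)) (adjoint (T j)) := fun i j => by
    rw [← ContinuousLinearMap.star_eq_adjoint, ← ContinuousLinearMap.star_eq_adjoint]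
    exact (hcomm i j).star_star
  let A : Fin d × Fin 2 → H →L[ℂ] H := fun x => if x.2 = 0 then adjoint (T x.1) else T x.1
  have hA0 : ∀ k, A (k, 0) = adjoint (T k) := fun k => by simp [A]
  have hA1 : ∀ k, A (k, 1) = T k := fun k => by simp [A]
  have hA : ∀ x y, x.2 = y.2 → A x * A y = A y * A x := by
    rintro ⟨i, a⟩ ⟨j, b⟩ h
    obtain rfl : a = b := h
    fin_cases a
    · exact hcs i j
    · exact hcomm i j
  rw [genComm, gc_stdPoly]
  have hB : ∀ x : Fin d × Fin 2,
      (if ((gcEquiv d x : Fin (2 * d)) : ℕ) % 2 = 0 then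
        adjoint (T ⟨((gcEquiv d x : Fin (2 * d)) : ℕ) / 2, by
          have := (gcEquiv d x).isLt; omega⟩)
      else T ⟨((gcEquiv d x : Fin (2 * d)) : ℕ) / 2, by
          have := (gcEquiv d x).isLt; omega⟩) = A x := by
    rintro ⟨k, b⟩
    have hk : (⟨((gcEquiv d (k, b) : Fin (2 * d)) : ℕ) / 2, by
        have := (gcEquiv d (k, b)).isLt; omega⟩ : Fin d) = k := by
      apply Fin.ext
      have := gcEquiv_val k b
      simp only [this]
      omega
    rw [hk, gcEquiv_val]
    fin_cases b <;> simp [A, Nat.add_mod]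
  simp only [hB]
  rw [gc_core A hA, detOp, Finset.sum_comm]
  simp only [hA0, hA1]
  refine Eq.trans ?_ (Fintype.sum_equiv (finTwoArrowEquiv (Equiv.Perm (Fin d))) _
    (fun q : Equiv.Perm (Fin d) × Equiv.Perm (Fin d) =>
      ((Equiv.Perm.sign q.1 * Equiv.Perm.sign q.2 : ℤˣ) : ℤ) •
        (List.ofFn fun k => adjoint (T (q.1 k)) * T (q.2 k) -
          T (q.2 k) * adjoint (T (q.1 k))).prod) (fun p => rfl)).symm
  rw [Fintype.sum_prod_type_right]
  refine Finset.sum_congr rfl fun τ _ => ?_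
  refine Fintype.sum_equiv (Equiv.mulRight τ) _ _ fun σ => ?_
  simp [cmt, mul_assoc]
end
end

section
/- Let N = (N_1, N_2) be a commuting pair of bounded normal operators on a complex Hilbert space H and let A = (A_1, A_2) be a pair of 2×2 complex matrices. If the operators N_1 ⊗ A_1 and N_2 ⊗ A_2 on H ⊗ ℂ² commute (i.e. the pair N ⊗ A is a commuting 2-normal pair), then dEt([[(N ⊗ A)*, N ⊗ A]]) = 0. -/
open ContinuousLinearMap MeasureTheory
open scoped ENNReal NNReal ComplexOrder

noncomputable section

variable {H H₁ H₂ K : Type*}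
variable [NormedAddCommGroup H] [InnerProductSpace ℂ H] [CompleteSpace H]
variable [NormedAddCommGroup H₁] [InnerProductSpace ℂ H₁] [CompleteSpace H₁]
variable [NormedAddCommGroup H₂] [InnerProductSpace ℂ H₂] [CompleteSpace H₂]
variable [NormedAddCommGroup K] [InnerProductSpace ℂ K] [CompleteSpace K]

theorem amitsur_two (a b c d : Matrix (Fin 2) (Fin 2) ℂ) :
    ((a * b - b * a) * (c * d - d * c) + (c * d - d * c) * (a * b - b * a))
    - ((a * c - c * a) * (b * d - d * b) + (b * d - d * b) * (a * c - c * a))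
    + ((a * d - d * a) * (b * c - c * b) + (b * c - c * b) * (a * d - d * a)) = 0 := by
  ext i j
  fin_cases i <;> fin_cases j <;>
    simp [Matrix.mul_apply, Fin.sum_univ_two, Matrix.sub_apply, Matrix.add_apply] <;> ring

theorem dense_ext {F : Type*} [NormedAddCommGroup F] [InnerProductSpace ℂ F]
    {tmul : H₁ →ₗ[ℂ] F →ₗ[ℂ] H} (ht : IsHilbertTensor tmul) {C D : H →L[ℂ] H}
    (h : ∀ x y, C (tmul x y) = D (tmul x y)) : C = D := by
  apply ContinuousLinearMap.ext_on ht.dense_span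
  rintro _ ⟨x, y, rfl⟩
  exact h x y

theorem tensorOp_mul {tmul : H₁ →ₗ[ℂ] H₂ →ₗ[ℂ] H} {A A' : H₁ →L[ℂ] H₁} {B B' : H₂ →L[ℂ] H₂}
    {C C' : H →L[ℂ] H} (h : IsTensorOp tmul A B C) (h' : IsTensorOp tmul A' B' C') :
    IsTensorOp tmul (A * A') (B * B') (C * C') := by
  intro x y
  simp [ContinuousLinearMap.mul_apply, h' x y, h _ _]

theorem tensorOp_adjoint {tmul : H₁ →ₗ[ℂ] H₂ →ₗ[ℂ] H} (ht : IsHilbertTensor tmul)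
    {A : H₁ →L[ℂ] H₁} {B : H₂ →L[ℂ] H₂}
    {C : H →L[ℂ] H} (h : IsTensorOp tmul A B C) :
    IsTensorOp tmul (star A) (star B) (adjoint C) := by
  intro x y
  apply ht.dense_span.eq_of_inner_left (𝕜 := ℂ)
  intro v hv
  induction hv using Submodule.span_induction with
  | mem v hv =>
    obtain ⟨p, q, rfl⟩ := hv
    rw [ContinuousLinearMap.adjoint_inner_left, h p q, ht.inner_tmul, ht.inner_tmul,
      ContinuousLinearMap.star_eq_adjoint, ContinuousLinearMap.star_eq_adjoint,
      ContinuousLinearMap.adjoint_inner_left, ContinuousLinearMap.adjoint_inner_left]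
  | zero => simp
  | add a b _ _ ha hb => simp only [inner_add_right, ha, hb]
  | smul c a _ ha => simp only [inner_smul_right, ha]

theorem tensorOp_cmt {tmul : H₁ →ₗ[ℂ] H₂ →ₗ[ℂ] H} {A A' : H₁ →L[ℂ] H₁} {B B' : H₂ →L[ℂ] H₂}
    {C C' : H →L[ℂ] H} (h : IsTensorOp tmul A B C) (h' : IsTensorOp tmul A' B' C')
    (hA : Commute A A') :
    IsTensorOp tmul (A * A') (cmt B B') (cmt C C') := by
  intro x y
  have h1 := tensorOp_mul h h' x y
  have h2 := tensorOp_mul h' h x y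
  simp only [cmt, ContinuousLinearMap.sub_apply, map_sub]
  rw [h1, h2, hA.eq]

/-- for a commuting pair of normal operators `N₁, N₂` and `2×2` matrices
`A₁, A₂`, if `(N₁ ⊗ A₁, N₂ ⊗ A₂)` is a commuting pair then its determinant operator is `0`. -/
theorem statement_13 (N₁ N₂ : H₁ →L[ℂ] H₁)
    (hN₁ : IsStarNormal N₁) (hN₂ : IsStarNormal N₂) (hN : Commute N₁ N₂)
    (A₁ A₂ : Matrix (Fin 2) (Fin 2) ℂ)
    (tmul : H₁ →ₗ[ℂ] (EuclideanSpace ℂ (Fin 2)) →ₗ[ℂ] H) (htmul : IsHilbertTensor tmul)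
    (T : Fin 2 → H →L[ℂ] H)
    (hT0 : IsTensorOp tmul N₁ (Matrix.toEuclideanCLM (𝕜 := ℂ) A₁) (T 0))
    (hT1 : IsTensorOp tmul N₂ (Matrix.toEuclideanCLM (𝕜 := ℂ) A₂) (T 1))
    (hTcomm : Commute (T 0) (T 1)) :
    detOp T = 0 := by
  have n1 : Commute (star N₁) N₁ := hN₁.star_comm_self
  have n2 : Commute (star N₂) N₂ := hN₂.star_comm_self
  have c1 : Commute (star N₁) N₂ := hN₁.commute_star_left hN
  have c2 : Commute (star N₂) N₁ := by simpa using c1.star_star.symm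
  have c3 : Commute (star N₁) (star N₂) := hN.star_star
  have a0 := tensorOp_adjoint htmul hT0
  have a1 := tensorOp_adjoint htmul hT1
  have e1 := tensorOp_mul (tensorOp_cmt a0 hT0 n1) (tensorOp_cmt a1 hT1 n2)
  have e2 := tensorOp_mul (tensorOp_cmt a1 hT1 n2) (tensorOp_cmt a0 hT0 n1)
  have e3 := tensorOp_mul (tensorOp_cmt a1 hT0 c2) (tensorOp_cmt a0 hT1 c1)
  have e4 := tensorOp_mul (tensorOp_cmt a0 hT1 c1) (tensorOp_cmt a1 hT0 c2)
  have m1 : star N₁ * N₁ * (star N₂ * N₂) = star N₁ * star N₂ * (N₁ * N₂) := by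
    rw [mul_assoc, ← mul_assoc N₁, ← c2.eq]; simp only [mul_assoc]
  have m4 : star N₁ * N₂ * (star N₂ * N₁) = star N₁ * star N₂ * (N₁ * N₂) := by
    rw [mul_assoc, ← mul_assoc N₂, ← n2.eq, hN.eq]; simp only [mul_assoc]
  have m2 : star N₂ * N₂ * (star N₁ * N₁) = star N₁ * star N₂ * (N₁ * N₂) := by
    rw [mul_assoc, ← mul_assoc N₂, ← c1.eq, hN.eq, c3.eq]; simp only [mul_assoc]
  have m3 : star N₂ * N₁ * (star N₁ * N₂) = star N₁ * star N₂ * (N₁ * N₂) := by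
    rw [mul_assoc, ← mul_assoc N₁, ← n1.eq, c3.eq]; simp only [mul_assoc]
  rw [m1] at e1
  rw [m2] at e2
  rw [m3] at e3
  rw [m4] at e4
  have hdet : detOp T = cmt (adjoint (T 0)) (T 0) * cmt (adjoint (T 1)) (T 1)
      + cmt (adjoint (T 1)) (T 1) * cmt (adjoint (T 0)) (T 0)
      - cmt (adjoint (T 1)) (T 0) * cmt (adjoint (T 0)) (T 1)
      - cmt (adjoint (T 0)) (T 1) * cmt (adjoint (T 1)) (T 0) := by
    have hu : (Finset.univ : Finset (Equiv.Perm (Fin 2))) = {1, Equiv.swap 0 1} := by decide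
    have hne : (1 : Equiv.Perm (Fin 2)) ≠ Equiv.swap 0 1 := by decide
    simp only [detOp, hu, Finset.sum_pair hne]
    simp [List.ofFn_succ]
    abel
  rw [hdet]
  apply dense_ext htmul
  intro x y
  simp only [ContinuousLinearMap.sub_apply, ContinuousLinearMap.add_apply,
    ContinuousLinearMap.zero_apply]
  rw [e1 x y, e2 x y, e3 x y, e4 x y, ← map_add, ← map_sub, ← map_sub]
  by_cases hA : A₁ * A₂ - A₂ * A₁ = 0
  · have hS := amitsur_two (star A₁) A₁ (star A₂) A₂
    have hz : Matrix.toEuclideanCLM (𝕜 := ℂ) (A₁ * A₂ - A₂ * A₁) = 0 := by rw [hA, map_zero]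
    have hS' := congrArg (Matrix.toEuclideanCLM (𝕜 := ℂ)) hS
    rw [hA] at hS'
    simp only [map_add, map_sub, map_mul, map_star, map_zero, mul_zero, zero_mul] at hS'
    set B₁ := Matrix.toEuclideanCLM (𝕜 := ℂ) A₁
    set B₂ := Matrix.toEuclideanCLM (𝕜 := ℂ) A₂
    have hS2 : cmt (star B₁) B₁ * cmt (star B₂) B₂ + cmt (star B₂) B₂ * cmt (star B₁) B₁
      - cmt (star B₂) B₁ * cmt (star B₁) B₂ - cmt (star B₁) B₂ * cmt (star B₂) B₁ = 0 := by
      rw [← hS']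
      simp only [cmt, mul_sub, sub_mul, mul_assoc]
      abel
    have := congrArg (fun f => f y) hS2
    simp only [ContinuousLinearMap.sub_apply, ContinuousLinearMap.add_apply,
      ContinuousLinearMap.zero_apply] at this
    rw [this, map_zero]
  · have hz : Matrix.toEuclideanCLM (𝕜 := ℂ) (A₁ * A₂ - A₂ * A₁) ≠ 0 := by
      intro h; exact hA ((map_eq_zero_iff _ (EquivLike.injective _)).mp h)
    obtain ⟨v, hv⟩ : ∃ v, Matrix.toEuclideanCLM (𝕜 := ℂ) (A₁ * A₂ - A₂ * A₁) v ≠ 0 := by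
      by_contra! hcon; exact hz (ContinuousLinearMap.ext hcon)
    have hk := tensorOp_cmt hT0 hT1 hN x v
    have hz0 : cmt (T 0) (T 1) = 0 := by rw [cmt, hTcomm.eq, sub_self]
    have hv' : cmt (Matrix.toEuclideanCLM (𝕜 := ℂ) A₁) (Matrix.toEuclideanCLM (𝕜 := ℂ) A₂) v ≠ 0 := by
      simpa only [cmt, map_sub, map_mul] using hv
    rw [hz0, ContinuousLinearMap.zero_apply] at hk
    have hi := htmul.inner_tmul ((N₁ * N₂) x) (cmt (Matrix.toEuclideanCLM (𝕜 := ℂ) A₁) (Matrix.toEuclideanCLM (𝕜 := ℂ) A₂) v)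
      ((N₁ * N₂) x) (cmt (Matrix.toEuclideanCLM (𝕜 := ℂ) A₁) (Matrix.toEuclideanCLM (𝕜 := ℂ) A₂) v)
    rw [← hk, inner_zero_left] at hi
    have hx : (N₁ * N₂) x = 0 := by
      rcases mul_eq_zero.mp hi.symm with h | h
      · exact inner_self_eq_zero.mp h
      · exact absurd (inner_self_eq_zero.mp h) hv'
    rw [ContinuousLinearMap.mul_apply, hx, map_zero, map_zero, LinearMap.zero_apply]
end
end

section
/- Let T = (T_1, …, T_d) be a commuting d-tuple of bounded operators on a complex Hilbert space H that is d-normal; that is, there exist a Hilbert space H̃, a unitary U : H → H̃ ⊗ ℂ^d, and for each k a d×d operator matrix A_k = ((A^{(k)}_{ij})) acting on H̃ ⊗ ℂ^d whose entries A^{(k)}_{ij} (over all k, i, j) form a pairwise commuting family of normal operators on H̃, such that U T_k U* = A_k for every k and the A_k pairwise commute. Then dEt([[T*, T]]) = 0. -/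
open ContinuousLinearMap MeasureTheory
open scoped ENNReal NNReal ComplexOrder

noncomputable section

variable {H H₁ H₂ K : Type*}
variable [NormedAddCommGroup H] [InnerProductSpace ℂ H] [CompleteSpace H]
variable [NormedAddCommGroup H₁] [InnerProductSpace ℂ H₁] [CompleteSpace H₁]
variable [NormedAddCommGroup H₂] [InnerProductSpace ℂ H₂] [CompleteSpace H₂]
variable [NormedAddCommGroup K] [InnerProductSpace ℂ K] [CompleteSpace K]

open Polynomial in
theorem al_derivative_charpoly {R : Type*} [CommRing R] {d : ℕ} (Y : Matrix (Fin d) (Fin d) R) :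
    derivative Y.charpoly = (Matrix.adjugate (Matrix.charmatrix Y)).trace := by
  classical
  have h : ∀ i, (Matrix.adjugate (Matrix.charmatrix Y)) i i =
      ∑ σ : Equiv.Perm (Fin d), ((Equiv.Perm.sign σ : ℤ) : R[X]) *
        ((∏ j ∈ Finset.univ.erase i, Matrix.charmatrix Y j (σ j)) *
          derivative (Matrix.charmatrix Y i (σ i))) := by
    intro i
    rw [Matrix.adjugate_apply, ← Matrix.det_transpose, Matrix.det_apply']
    refine Finset.sum_congr rfl fun σ _ => ?_
    congr 1
    rw [← Finset.prod_erase_mul _ _ (Finset.mem_univ i)]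
    congr 1
    · refine Finset.prod_congr rfl fun j hj => ?_
      simp [Matrix.updateRow_ne (Finset.ne_of_mem_erase hj)]
    · by_cases hσ : σ i = i
      · simp [hσ]
      · simp [hσ, Ne.symm hσ]
  rw [Matrix.trace, Matrix.charpoly, ← Matrix.det_transpose, Matrix.det_apply', derivative_sum]
  simp only [Matrix.diag_apply, h]
  rw [Finset.sum_comm]
  refine Finset.sum_congr rfl fun σ _ => ?_
  rw [← Finset.mul_sum, derivative_mul, derivative_intCast, zero_mul, zero_add,
    derivative_prod_finset]
  rfl

open Polynomial in
theorem al_pow_eq_zero {R : Type*} [CommRing R] {d : ℕ} (hR : ∀ n : ℕ, n ≠ 0 → IsUnit (n : R))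
    (Y : Matrix (Fin d) (Fin d) R) (hY : ∀ k : ℕ, (Y ^ (k + 1)).trace = 0) : Y ^ d = 0 := by
  classical
  set N := matPolyEquiv (Matrix.adjugate (Matrix.charmatrix Y)) with hN
  set p := Y.charpoly with hp
  have h1 : (X - C Y) * N = p.map (algebraMap R _) := by
    rw [hN, ← Matrix.matPolyEquiv_charmatrix, ← map_mul, Matrix.mul_adjugate, matPolyEquiv_smul_one]
    rfl
  have htr : ∀ k, (N.coeff k).trace = p.coeff (k + 1) * (k + 1) := by
    intro k
    rw [← coeff_derivative, al_derivative_charpoly, Matrix.trace, Matrix.trace, finsetSum_coeff]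
    refine Finset.sum_congr rfl fun i _ => ?_
    simp [hN, matPolyEquiv_coeff_apply]
  have hsucc : ∀ k, N.coeff k = Y * N.coeff (k + 1) + algebraMap R _ (p.coeff (k + 1)) := by
    intro k
    have := congrArg (fun q => q.coeff (k + 1)) h1
    simp only [sub_mul, coeff_sub, coeff_X_mul, coeff_C_mul, coeff_map] at this
    rw [← this]; abel
  have hzero : 0 = Y * N.coeff 0 + algebraMap R _ (p.coeff 0) := by
    have := congrArg (fun q => q.coeff 0) h1
    simp only [sub_mul, coeff_sub, mul_coeff_zero, coeff_X_zero, zero_mul,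
      coeff_map, coeff_C_zero] at this
    rw [← this]; abel
  have hmem : ∀ m k, N.natDegree < k + m → N.coeff k ∈ Algebra.adjoin R {Y} := by
    intro m
    induction m with
    | zero => intro k hk; rw [coeff_eq_zero_of_natDegree_lt (by simpa using hk)]; exact zero_mem _
    | succ m ih =>
      intro k hk
      rw [hsucc]
      exact add_mem (mul_mem (Algebra.self_mem_adjoin_singleton R Y) (ih _ (by omega)))
        (Subalgebra.algebraMap_mem _ _)
  have htrY : ∀ k, (Y * N.coeff k).trace = 0 := by
    intro k
    have := hmem (N.natDegree + 1) k (by omega)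
    rw [Algebra.adjoin_singleton_eq_range_aeval] at this
    obtain ⟨q, hq⟩ := this
    rw [← hq]
    simp only [AlgHom.toRingHom_eq_coe, RingHom.coe_coe, aeval_eq_sum_range]
    rw [Finset.mul_sum, Matrix.trace_sum]
    refine Finset.sum_eq_zero fun i _ => ?_
    rw [mul_smul_comm, Matrix.trace_smul, ← pow_succ', hY, smul_zero]
  have hpk : ∀ k : ℕ, (k : R) * p.coeff k = d * p.coeff k := by
    intro k
    have hs : ∀ r : R, (algebraMap R (Matrix (Fin d) (Fin d) R) r).trace = d * r := by
      intro r
      simp [Matrix.algebraMap_eq_diagonal, Matrix.trace_diagonal]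
    cases k with
    | zero =>
      have := congrArg Matrix.trace hzero
      rw [Matrix.trace_add, htrY, hs] at this
      simpa using this
    | succ k =>
      have := congrArg Matrix.trace (hsucc k)
      rw [Matrix.trace_add, htrY, hs, htr] at this
      push_cast
      rw [zero_add] at this
      rw [← this]; ring
  have hlt : ∀ k, k < d → p.coeff k = 0 := by
    intro k hk
    have h2 : ((d - k : ℕ) : R) * p.coeff k = 0 := by
      rw [Nat.cast_sub hk.le, sub_mul, hpk, sub_self]
    exact (hR (d - k) (by omega)).mul_right_eq_zero.mp h2
  rcases subsingleton_or_nontrivial R with hS | hS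
  · exact Subsingleton.elim _ _
  have hdeg : p.natDegree = d := by rw [hp, Matrix.charpoly_natDegree_eq_dim]; simp
  have hpX : p = X ^ d := by
    ext k
    rw [coeff_X_pow]
    rcases lt_trichotomy k d with h | h | h
    · rw [hlt k h, if_neg h.ne]
    · rw [if_pos h, h, ← hdeg]; exact Matrix.charpoly_monic Y
    · rw [if_neg h.ne', coeff_eq_zero_of_natDegree_lt (by omega)]
  have := Matrix.aeval_self_charpoly Y
  rw [← hp, hpX] at this
  simpa using this

theorem al_anti {C M : Type*} [CommRing C] [AddCommGroup M] [Module C M] (u v : M) :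
    ExteriorAlgebra.ι C u * ExteriorAlgebra.ι C v =
      -(ExteriorAlgebra.ι C v * ExteriorAlgebra.ι C u) :=
  eq_neg_of_add_eq_zero_left (ExteriorAlgebra.ι_add_mul_swap u v)

theorem al_central {C M : Type*} [CommRing C] [AddCommGroup M] [Module C M] (u v : M) :
    ExteriorAlgebra.ι C u * ExteriorAlgebra.ι C v ∈
      Subalgebra.center C (ExteriorAlgebra C M) := by
  rw [Subalgebra.mem_center_iff]
  intro w
  induction w using ExteriorAlgebra.induction with
  | algebraMap r => exact Algebra.commutes r _
  | ι x =>
    rw [← mul_assoc, al_anti x u, neg_mul, mul_assoc, al_anti x v, mul_neg, neg_neg, mul_assoc]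
  | mul a b ha hb => rw [mul_assoc, hb, ← mul_assoc, ha, mul_assoc]
  | add a b ha hb => rw [add_mul, mul_add, ha, hb]

theorem al_nilp {C M : Type*} [CommRing C] [AddCommGroup M] [Module C M] {d : ℕ}
    (hC : ∀ n : ℕ, n ≠ 0 → IsUnit (n : C)) (x : Fin d → Fin d → M)
    (X : Matrix (Fin d) (Fin d) (ExteriorAlgebra C M))
    (hX : ∀ i j, X i j = ExteriorAlgebra.ι C (x i j)) : (X * X) ^ d = 0 := by
  classical
  set Z := Subalgebra.center C (ExteriorAlgebra C M) with hZ
  have hmem : ∀ i j, (X * X) i j ∈ Z := by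
    intro i j
    rw [Matrix.mul_apply]
    refine sum_mem fun k _ => ?_
    rw [hX, hX]
    exact al_central _ _
  let v : Z →+* ExteriorAlgebra C M := Z.val.toRingHom
  have hv : Function.Injective v := Subtype.val_injective
  let Y : Matrix (Fin d) (Fin d) Z := Matrix.of fun i j => ⟨(X * X) i j, hmem i j⟩
  have hY : v.mapMatrix Y = X * X := by
    ext i j; rfl
  have hYk : ∀ k, v.mapMatrix (Y ^ k) = (X * X) ^ k := by
    intro k; rw [map_pow, hY]
  have key : Y ^ d = 0 := by
    refine al_pow_eq_zero ?_ Y ?_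
    · intro n hn
      have := (hC n hn).map (algebraMap C Z)
      simpa using this
    · intro k
      apply hv
      rw [map_zero]
      have h1 : v (Y ^ (k + 1)).trace = ((X * X) ^ (k + 1)).trace := by
        rw [← hYk]
        simp [Matrix.trace]
      rw [h1]
      have h2 : ((X * X) ^ (k + 1)).trace = -((X * X) ^ (k + 1)).trace := by
        have e1 : (X * X) ^ (k + 1) = X * (X * (X * X) ^ k) := by rw [pow_succ', mul_assoc]
        have e2 : (X * X) ^ (k + 1) = (X * (X * X) ^ k) * X := by
          have : Commute X ((X * X) ^ k) :=
            ((Commute.refl X).mul_right (Commute.refl X)).pow_right k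
          rw [mul_assoc, ← this.eq, e1]
        conv_lhs => rw [e1]
        rw [e2]
        simp only [Matrix.trace, Matrix.diag_apply, Matrix.mul_apply (M := X) (N := X * (X * X) ^ k),
          Matrix.mul_apply (M := X * (X * X) ^ k) (N := X)]
        rw [Finset.sum_comm, ← Finset.sum_neg_distrib]
        refine Finset.sum_congr rfl fun j _ => ?_
        rw [← Finset.sum_neg_distrib]
        refine Finset.sum_congr rfl fun i _ => ?_
        rw [Matrix.mul_apply, Finset.mul_sum, Finset.sum_mul, ← Finset.sum_neg_distrib]
        refine Finset.sum_congr rfl fun l _ => ?_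
        have hc : ((X * X) ^ k) l i ∈ Z := by
          rw [← hYk]; exact (Y ^ k) l i |>.2
        rw [mul_assoc, ← Subalgebra.mem_center_iff.mp hc (X i j), ← mul_assoc, ← mul_assoc,
          hX, hX, al_anti, neg_mul]
      have h3 : (2 : ExteriorAlgebra C M) * ((X * X) ^ (k + 1)).trace = 0 := by
        rw [two_mul]; nth_rewrite 1 [h2]; exact neg_add_cancel _
      have h4 : IsUnit (2 : ExteriorAlgebra C M) := by
        have := (hC 2 two_ne_zero).map (algebraMap C (ExteriorAlgebra C M))
        rwa [map_natCast] at this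
      exact h4.mul_right_eq_zero.mp h3
  rw [← hYk, key, map_zero]

/-- the matrix `A` with coefficients multiplied by `w` -/
def alEmb {C L : Type*} [CommRing C] [Ring L] [Algebra C L] {d : ℕ}
    (A : Matrix (Fin d) (Fin d) C) (w : L) : Matrix (Fin d) (Fin d) L :=
  Matrix.of fun i j => A i j • w

theorem alEmb_mul {C L : Type*} [CommRing C] [Ring L] [Algebra C L] {d : ℕ}
    (A B : Matrix (Fin d) (Fin d) C) (w z : L) :
    alEmb A w * alEmb B z = alEmb (A * B) (w * z) := by
  ext i j
  simp only [alEmb, Matrix.mul_apply, Matrix.of_apply, Finset.sum_smul]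
  refine Finset.sum_congr rfl fun k _ => ?_
  rw [smul_mul_smul_comm]

theorem alEmb_sum_pow {C L α : Type*} [CommRing C] [Ring L] [Algebra C L] {d : ℕ} [Fintype α]
    (B : α → Matrix (Fin d) (Fin d) C) (g : α → L) (n : ℕ) :
    (∑ a, alEmb (B a) (g a)) ^ n = ∑ s : Fin n → α,
      alEmb (List.ofFn fun k => B (s k)).prod (List.ofFn fun k => g (s k)).prod := by
  classical
  induction n with
  | zero =>
    ext i j
    simp [alEmb, Matrix.one_apply]
  | succ n ih =>
    rw [pow_succ', ih, Finset.sum_mul_sum,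
      ← (Fin.consEquiv (fun _ : Fin (n + 1) => α)).sum_comp, Fintype.sum_prod_type]
    refine Finset.sum_congr rfl fun a _ => Finset.sum_congr rfl fun s _ => ?_
    rw [alEmb_mul]
    simp [List.ofFn_succ, Fin.consEquiv]

theorem al_sum_anti {C L : Type*} [CommRing C] [Ring L] [Algebra C L] {d : ℕ}
    (h2 : IsUnit (2 : C)) {α : Type*} [Fintype α]
    (N : α → Matrix (Fin d) (Fin d) C) (e : α → L)
    (hN : ∀ a b, N a * N b = N b * N a) (he : ∀ a b, e a * e b = -(e b * e a)) :
    (∑ a, alEmb (N a) (e a)) * (∑ a, alEmb (N a) (e a)) = 0 := by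
  have hL : IsUnit (2 : L) := by
    have := h2.map (algebraMap C L)
    rwa [map_ofNat] at this
  have h1 : (∑ a, alEmb (N a) (e a)) * (∑ a, alEmb (N a) (e a)) =
      -((∑ a, alEmb (N a) (e a)) * (∑ a, alEmb (N a) (e a))) := by
    conv_lhs => rw [Finset.sum_mul_sum, Finset.sum_comm]
    rw [Finset.sum_mul_sum, ← Finset.sum_neg_distrib]
    refine Finset.sum_congr rfl fun a _ => ?_
    rw [← Finset.sum_neg_distrib]
    refine Finset.sum_congr rfl fun b _ => ?_
    rw [alEmb_mul, alEmb_mul, hN b a, he b a]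
    ext i j
    simp [alEmb]
  ext i j
  have h2 := congrFun (congrFun h1 i) j
  rw [Matrix.neg_apply] at h2
  refine hL.mul_right_eq_zero.mp ?_
  rw [two_mul]; nth_rewrite 1 [h2]; exact neg_add_cancel _

/-- interleaving of indices -/
def alIdx (d : ℕ) : Fin d ⊕ Fin d ≃ Fin (d * 2) :=
  (Equiv.boolProdEquivSum (Fin d)).symm.trans ((Equiv.prodComm _ _).trans
    ((Equiv.prodCongr (Equiv.refl _) finTwoEquiv.symm).trans finProdFinEquiv))

theorem al_functional (C : Type*) [CommRing C] (d : ℕ) :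
    ∃ φ : ExteriorAlgebra C (Fin d ⊕ Fin d → C) →ₗ[C] C, ∀ s t : Fin d → Fin d,
      φ (List.ofFn fun k => ExteriorAlgebra.ι C (Pi.single (Sum.inl (s k)) 1) *
          ExteriorAlgebra.ι C (Pi.single (Sum.inr (t k)) 1)).prod =
        (Matrix.of fun i j => if s i = j then (1 : C) else 0).det *
        (Matrix.of fun i j => if t i = j then (1 : C) else 0).det := by
  classical
  let g : (Fin d ⊕ Fin d → C) [⋀^Fin (d * 2)]→ₗ[C] C :=
    (Matrix.detRowAlternating (n := Fin d ⊕ Fin d) (R := C)).domDomCongr (alIdx d)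
  refine ⟨ExteriorAlgebra.liftAlternating (Function.update 0 (d * 2) g), fun s t => ?_⟩
  let w : Fin (d * 2) → (Fin d ⊕ Fin d → C) := fun k =>
    Sum.elim (fun a => Pi.single (Sum.inl (s a)) 1) (fun b => Pi.single (Sum.inr (t b)) 1)
      ((alIdx d).symm k)
  have hw0 : ∀ k : Fin d, ∀ h, w ⟨k * 2 + 0, h⟩ = Pi.single (Sum.inl (s k)) 1 := by
    intro k h
    have : (⟨k * 2 + 0, h⟩ : Fin (d * 2)) = alIdx d (Sum.inl k) := by
      ext; simp [alIdx, finTwoEquiv]; ring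
    simp only [w, this, Equiv.symm_apply_apply, Sum.elim_inl]
  have hw1 : ∀ k : Fin d, ∀ h, w ⟨k * 2 + 1, h⟩ = Pi.single (Sum.inr (t k)) 1 := by
    intro k h
    have : (⟨k * 2 + 1, h⟩ : Fin (d * 2)) = alIdx d (Sum.inr k) := by
      ext; simp [alIdx, finTwoEquiv]; ring
    simp only [w, this, Equiv.symm_apply_apply, Sum.elim_inr]
  have h1 : (List.ofFn fun k => ExteriorAlgebra.ι C (Pi.single (Sum.inl (s k)) (1 : C)) *
          ExteriorAlgebra.ι C (Pi.single (Sum.inr (t k)) 1)).prod =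
      ExteriorAlgebra.ιMulti C (d * 2) w := by
    rw [ExteriorAlgebra.ιMulti_apply, List.ofFn_mul, List.prod_flatten, List.map_ofFn]
    congr 2
    funext k
    have a0 := hw0 k (by omega)
    have a1 := hw1 k (by omega)
    simp only [Nat.add_zero] at a0
    simp [a0, a1]
  rw [h1, ExteriorAlgebra.liftAlternating_apply_ιMulti, Function.update_self]
  have h2 : g w = (Matrix.fromBlocks (Matrix.of fun i j => if s i = j then (1 : C) else 0) 0 0
      (Matrix.of fun i j => if t i = j then (1 : C) else 0)).det := by
    simp only [g, AlternatingMap.domDomCongr_apply]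
    change Matrix.det _ = _
    congr 1
    ext i j
    rcases i with i | i <;> rcases j with j | j <;>
      simp [w, Pi.single_apply, eq_comm]
  rw [h2, Matrix.det_fromBlocks_zero₂₁]

theorem al_det_perm (C : Type*) [CommRing C] {d : ℕ} (σ : Equiv.Perm (Fin d)) :
    (Matrix.of fun i j => if σ i = j then (1 : C) else 0).det = (Equiv.Perm.sign σ : ℤ) := by
  rw [← Matrix.det_permutation]
  congr 1
  ext i j
  simp [PEquiv.toMatrix_apply, eq_comm]

theorem al_det_zero (C : Type*) [CommRing C] {d : ℕ} (s : Fin d → Fin d)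
    (hs : s ∉ Set.range fun σ : Equiv.Perm (Fin d) => (σ : Fin d → Fin d)) :
    (Matrix.of fun i j => if s i = j then (1 : C) else 0).det = 0 := by
  have : ¬ Function.Injective s := fun h =>
    hs ⟨Equiv.ofBijective s (Finite.injective_iff_bijective.mp h), rfl⟩
  simp only [Function.Injective, not_forall] at this
  obtain ⟨i, j, hij, hne⟩ := this
  refine Matrix.det_zero_of_row_eq hne ?_
  funext k
  simp [hij]

theorem al_main {C : Type*} [CommRing C] {d : ℕ}
    (hC : ∀ n : ℕ, n ≠ 0 → IsUnit (n : C)) (N M : Fin d → Matrix (Fin d) (Fin d) C)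
    (hN : ∀ a b, N a * N b = N b * N a) (hM : ∀ a b, M a * M b = M b * M a) :
    ∑ σ : Equiv.Perm (Fin d), ∑ τ : Equiv.Perm (Fin d), ((Equiv.Perm.sign σ : ℤ) •
      (List.ofFn fun k => N (σ (τ k)) * M (τ k) - M (τ k) * N (σ (τ k))).prod) = 0 := by
  classical
  obtain ⟨φ, hφ⟩ := al_functional C d
  let e : Fin d → ExteriorAlgebra C (Fin d ⊕ Fin d → C) := fun a =>
    ExteriorAlgebra.ι C (Pi.single (Sum.inl a) 1)
  let f : Fin d → ExteriorAlgebra C (Fin d ⊕ Fin d → C) := fun a =>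
    ExteriorAlgebra.ι C (Pi.single (Sum.inr a) 1)
  let B : Fin d × Fin d → Matrix (Fin d) (Fin d) C := fun p => N p.1 * M p.2 - M p.2 * N p.1
  set P := ∑ a, alEmb (N a) (e a) with hP
  set Q := ∑ a, alEmb (M a) (f a) with hQ
  have h2 : IsUnit (2 : C) := by simpa using hC 2 two_ne_zero
  have hPP : P * P = 0 := al_sum_anti h2 N e hN fun a b => al_anti _ _
  have hQQ : Q * Q = 0 := al_sum_anti h2 M f hM fun a b => al_anti _ _
  have hXX : (P + Q) * (P + Q) = ∑ p : Fin d × Fin d, alEmb (B p) (e p.1 * f p.2) := by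
    have : (P + Q) * (P + Q) = P * Q + Q * P := by
      rw [add_mul, mul_add, mul_add, hPP, hQQ]; abel
    rw [this, hP, hQ, Finset.sum_mul_sum, Finset.sum_mul_sum,
      Finset.sum_comm (f := fun i j => alEmb (M i) (f i) * alEmb (N j) (e j)),
      Fintype.sum_prod_type, ← Finset.sum_add_distrib]
    refine Finset.sum_congr rfl fun a _ => ?_
    rw [← Finset.sum_add_distrib]
    refine Finset.sum_congr rfl fun b _ => ?_
    rw [alEmb_mul, alEmb_mul, show f b * e a = -(e a * f b) from al_anti _ _]
    ext i j
    simp [alEmb, B, add_smul, sub_eq_add_neg]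
  have hnil : ((P + Q) * (P + Q)) ^ d = 0 := by
    refine al_nilp hC (fun i j => ∑ a, N a i j • Pi.single (Sum.inl a) 1 +
      ∑ a, M a i j • Pi.single (Sum.inr a) 1) _ fun i j => ?_
    rw [hP, hQ, map_add, map_sum, map_sum]
    simp [alEmb, Matrix.add_apply, Matrix.sum_apply, e, f]
  rw [hXX, alEmb_sum_pow] at hnil
  let D : (Fin d → Fin d) → C := fun s => (Matrix.of fun i j => if s i = j then (1 : C) else 0).det
  have hsum : ∑ s : Fin d → Fin d, ∑ t : Fin d → Fin d,
      (D s * D t) • (List.ofFn fun k => B (s k, t k)).prod = 0 := by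
    rw [← Fintype.sum_prod_type' (f := fun s t : Fin d → Fin d =>
        (D s * D t) • (List.ofFn fun k => B (s k, t k)).prod),
      ← (Equiv.arrowProdEquivProdArrow (Fin d) (fun _ => Fin d) (fun _ => Fin d)).sum_comp]
    ext i j
    have := congrArg φ (congrFun (congrFun hnil i) j)
    rw [Matrix.sum_apply, map_sum] at this
    rw [Matrix.sum_apply]
    simp only [Matrix.zero_apply, map_zero] at this ⊢
    rw [← this]
    refine Finset.sum_congr rfl fun s _ => ?_
    simp only [alEmb, Matrix.of_apply, map_smul, e, f]
    rw [hφ (fun k => (s k).1) (fun k => (s k).2), Matrix.smul_apply, smul_eq_mul, smul_eq_mul,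
      mul_comm]
    rfl
  rw [← hsum]
  have hinj : Function.Injective fun σ : Equiv.Perm (Fin d) => (σ : Fin d → Fin d) :=
    DFunLike.coe_injective
  rw [← Fintype.sum_of_injective _ hinj (fun σ => ∑ t : Fin d → Fin d,
      (D σ * D t) • (List.ofFn fun k => B (σ k, t k)).prod) _ ?_ fun _ => rfl]
  · have : ∀ σ : Equiv.Perm (Fin d), ∑ t : Fin d → Fin d,
      (D σ * D t) • (List.ofFn fun k => B (σ k, t k)).prod = ∑ τ : Equiv.Perm (Fin d),
      (D σ * D τ) • (List.ofFn fun k => B (σ k, τ k)).prod := by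
      intro σ
      rw [← Fintype.sum_of_injective _ hinj (fun τ =>
        (D σ * D τ) • (List.ofFn fun k => B (σ k, τ k)).prod) _ ?_ fun _ => rfl]
      intro t ht
      rw [show D t = 0 from al_det_zero C t ht, mul_zero, zero_smul]
    simp only [this]
    rw [Finset.sum_comm, Finset.sum_comm (f := fun σ τ : Equiv.Perm (Fin d) =>
      (D σ * D τ) • (List.ofFn fun k => B (σ k, τ k)).prod)]
    refine Finset.sum_congr rfl fun τ _ => ?_
    rw [← Equiv.sum_comp (Equiv.mulRight τ) (fun σ : Equiv.Perm (Fin d) => (D σ * D τ) • (List.ofFn fun k => B (σ k, τ k)).prod)]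
    refine Finset.sum_congr rfl fun σ _ => ?_
    have hD : D (Equiv.mulRight τ σ) * D τ = ((Equiv.Perm.sign σ : ℤ) : C) := by
      simp only [D, al_det_perm]
      rw [← Int.cast_mul, Equiv.coe_mulRight, Equiv.Perm.sign_mul, Units.val_mul, mul_assoc,
        ← Units.val_mul, Int.units_mul_self, Units.val_one, mul_one]
    rw [hD, Int.cast_smul_eq_zsmul]
    rfl
  · intro s hs
    refine Finset.sum_eq_zero fun t _ => ?_
    rw [show D s = 0 from al_det_zero C s hs, zero_mul, zero_smul]

/-- the operator `S` is represented by the matrix `M` -/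
def AlRep {H Ht C : Type*} [NormedAddCommGroup H] [InnerProductSpace ℂ H]
    [NormedAddCommGroup Ht] [InnerProductSpace ℂ Ht] [CommRing C] {d : ℕ}
    (U : H ≃ₗᵢ[ℂ] (PiLp 2 fun _ : Fin d => Ht)) (ρ : C →+* (Ht →L[ℂ] Ht))
    (S : H →L[ℂ] H) (M : Matrix (Fin d) (Fin d) C) : Prop :=
  ∀ x i, (U (S x)) i = ∑ j, ρ (M i j) ((U x) j)

section AlRepSection

variable {H Ht C : Type*} [NormedAddCommGroup H] [InnerProductSpace ℂ H]
    [NormedAddCommGroup Ht] [InnerProductSpace ℂ Ht] [CommRing C] {d : ℕ}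
    {U : H ≃ₗᵢ[ℂ] (PiLp 2 fun _ : Fin d => Ht)} {ρ : C →+* (Ht →L[ℂ] Ht)}

theorem alRep_mul {S S' : H →L[ℂ] H} {M M' : Matrix (Fin d) (Fin d) C}
    (h : AlRep U ρ S M) (h' : AlRep U ρ S' M') : AlRep U ρ (S * S') (M * M') := by
  intro x i
  rw [ContinuousLinearMap.mul_apply, h]
  simp only [h' x, map_sum, Matrix.mul_apply, map_mul, ContinuousLinearMap.sum_apply,
    ContinuousLinearMap.mul_apply]
  rw [Finset.sum_comm]

theorem alRep_sub {S S' : H →L[ℂ] H} {M M' : Matrix (Fin d) (Fin d) C}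
    (h : AlRep U ρ S M) (h' : AlRep U ρ S' M') : AlRep U ρ (S - S') (M - M') := by
  intro x i
  simp [h x i, h' x i]

theorem alRep_one : AlRep U ρ 1 1 := by
  intro x i
  rw [Finset.sum_eq_single i]
  · simp
  · intro j _ hj
    simp [Matrix.one_apply_ne (Ne.symm hj)]
  · simp

theorem alRep_zsmul (n : ℤ) {S : H →L[ℂ] H} {M : Matrix (Fin d) (Fin d) C}
    (h : AlRep U ρ S M) : AlRep U ρ (n • S) (n • M) := by
  intro x i
  simp [h x i, Finset.smul_sum]

theorem alRep_sum {α : Type*} (s : Finset α) {S : α → H →L[ℂ] H}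
    {M : α → Matrix (Fin d) (Fin d) C}
    (h : ∀ a, AlRep U ρ (S a) (M a)) : AlRep U ρ (∑ a ∈ s, S a) (∑ a ∈ s, M a) := by
  intro x i
  simp only [ContinuousLinearMap.sum_apply, map_sum, Matrix.sum_apply, WithLp.ofLp_sum,
    Finset.sum_apply, h _ x i]
  rw [Finset.sum_comm]

theorem alRep_list {n : ℕ} {S : Fin n → H →L[ℂ] H} {M : Fin n → Matrix (Fin d) (Fin d) C}
    (h : ∀ a, AlRep U ρ (S a) (M a)) :
    AlRep U ρ (List.ofFn S).prod (List.ofFn M).prod := by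
  induction n with
  | zero => simpa using alRep_one
  | succ n ih =>
    rw [List.ofFn_succ, List.ofFn_succ, List.prod_cons, List.prod_cons]
    exact alRep_mul (h 0) (ih fun a => h a.succ)

theorem alRep_unique (hρ : Function.Injective ρ) {S : H →L[ℂ] H}
    {M M' : Matrix (Fin d) (Fin d) C}
    (h : AlRep U ρ S M) (h' : AlRep U ρ S M') : M = M' := by
  classical
  ext i j
  apply hρ
  ext v
  have h1 := (h (U.symm (WithLp.toLp 2 (Pi.single j v))) i).symm.trans
    (h' (U.symm (WithLp.toLp 2 (Pi.single j v))) i)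
  rw [LinearIsometryEquiv.apply_symm_apply] at h1
  rw [Finset.sum_eq_single j, Finset.sum_eq_single j] at h1
  · simpa using h1
  all_goals simp +contextual [Pi.single_apply]

theorem alRep_adjoint [CompleteSpace H] [CompleteSpace Ht] {S : H →L[ℂ] H}
    {M M' : Matrix (Fin d) (Fin d) C} (h : AlRep U ρ S M)
    (hM : ∀ i j, ρ (M' i j) = ContinuousLinearMap.adjoint (ρ (M j i))) :
    AlRep U ρ (ContinuousLinearMap.adjoint S) M' := by
  intro x i
  have key : U (ContinuousLinearMap.adjoint S x) =
      WithLp.toLp 2 (fun i => ∑ j, ρ (M' i j) ((U x) j)) := by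
    refine ext_inner_left ℂ fun y => ?_
    obtain ⟨y, rfl⟩ := U.surjective y
    rw [LinearIsometryEquiv.inner_map_map, ContinuousLinearMap.adjoint_inner_right,
      ← LinearIsometryEquiv.inner_map_map U, PiLp.inner_apply, PiLp.inner_apply]
    simp only [h y, sum_inner, inner_sum, hM, ContinuousLinearMap.adjoint_inner_right]
    rw [Finset.sum_comm]
  rw [key]

end AlRepSection

/-- a commuting `d`-tuple which is `d`-normal (unitarily equivalent to `d × d`
operator matrices with commuting normal entries) has vanishing determinant operator. -/
theorem statement_14 {d : ℕ} {Ht : Type*}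
    [NormedAddCommGroup Ht] [InnerProductSpace ℂ Ht] [CompleteSpace Ht]
    (T : Fin d → H →L[ℂ] H) (hcomm : ∀ i j, Commute (T i) (T j))
    (U : H ≃ₗᵢ[ℂ] (PiLp 2 fun _ : Fin d => Ht))
    (E : Fin d → Fin d → Fin d → (Ht →L[ℂ] Ht))
    (hEnormal : ∀ k i j, IsStarNormal (E k i j))
    (hEcomm : ∀ k i j k' i' j', Commute (E k i j) (E k' i' j'))
    (A : Fin d → (PiLp 2 fun _ : Fin d => Ht) →L[ℂ] (PiLp 2 fun _ : Fin d => Ht))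
    (hA : ∀ k x i, (A k x) i = ∑ j, E k i j (x j))
    (hAcomm : ∀ k l, Commute (A k) (A l))
    (hU : ∀ k x, U (T k x) = A k (U x)) :
    detOp T = 0 := by
  classical
  set s : Set (Ht →L[ℂ] Ht) := Set.range fun p : Fin d × Fin d × Fin d => E p.1 p.2.1 p.2.2 with hs
  have hcs : ∀ a ∈ s, ∀ b ∈ s, a * b = b * a := by
    rintro _ ⟨p, rfl⟩ _ ⟨q, rfl⟩
    exact hEcomm _ _ _ _ _ _
  have hcs' : ∀ a ∈ s, ∀ b ∈ s, a * star b = star b * a := by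
    rintro _ ⟨p, rfl⟩ _ ⟨q, rfl⟩
    exact (hEnormal _ _ _).commute_star_right (hEcomm _ _ _ _ _ _)
  haveI := StarAlgebra.isMulCommutative_adjoin ℂ hcs hcs'
  letI : CommRing (StarAlgebra.adjoin ℂ s) := by
    open scoped IsMulCommutative in infer_instance
  let ρ : StarAlgebra.adjoin ℂ s →+* (Ht →L[ℂ] Ht) :=
    (StarAlgebra.adjoin ℂ s).toSubalgebra.val.toRingHom
  have hρ : Function.Injective ρ := Subtype.val_injective
  let M : Fin d → Matrix (Fin d) (Fin d) (StarAlgebra.adjoin ℂ s) := fun k =>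
    Matrix.of fun i j => ⟨E k i j, StarAlgebra.subset_adjoin ℂ s ⟨(k, i, j), rfl⟩⟩
  let N : Fin d → Matrix (Fin d) (Fin d) (StarAlgebra.adjoin ℂ s) := fun k =>
    Matrix.of fun i j => star (M k j i)
  have hT : ∀ k, AlRep U ρ (T k) (M k) := by
    intro k x i
    rw [hU, hA]
    rfl
  have hTs : ∀ k, AlRep U ρ (adjoint (T k)) (N k) := fun k =>
    alRep_adjoint (hT k) fun i j => rfl
  have hMM : ∀ a b, M a * M b = M b * M a := by
    intro a b
    refine alRep_unique hρ (alRep_mul (hT a) (hT b)) ?_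
    rw [(hcomm a b).eq]
    exact alRep_mul (hT b) (hT a)
  have hNN : ∀ a b, N a * N b = N b * N a := by
    intro a b
    refine alRep_unique hρ (alRep_mul (hTs a) (hTs b)) ?_
    have : adjoint (T a) * adjoint (T b) = adjoint (T b) * adjoint (T a) :=
      ((hcomm a b).star_star).eq
    rw [this]
    exact alRep_mul (hTs b) (hTs a)
  have hunit : ∀ n : ℕ, n ≠ 0 → IsUnit (n : StarAlgebra.adjoin ℂ s) := by
    intro n hn
    have h1 : IsUnit (n : ℂ) := IsUnit.mk0 _ (Nat.cast_ne_zero.mpr hn)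
    have := h1.map (algebraMap ℂ (StarAlgebra.adjoin ℂ s))
    rwa [map_natCast] at this
  have hz := al_main hunit N M hNN hMM
  have hrep : AlRep U ρ (detOp T) 0 := by
    rw [← hz]
    refine alRep_sum _ fun σ => alRep_sum _ fun τ => alRep_zsmul _ (alRep_list fun k => ?_)
    exact alRep_sub (alRep_mul (hTs _) (hT _)) (alRep_mul (hT _) (hTs _))
  ext x
  apply U.injective
  ext i
  rw [hrep x i]
  simp
end
end

section
/- Let T = (T_1, …, T_d) be an m-polynomially cyclic commuting d-tuple of bounded operators on a complex separable Hilbert space H, with P_N the orthogonal projection onto H_N (the closed span of monomials in T of total degree ≤ N applied to a cyclic set of m vectors), and assume P_N T_j P_N^⊥ = 0 for all 1 ≤ j ≤ d. Then |trace(P_N dEt([[T*, T]]) P_N)| ≤ m · C(N+d−1, d−1) · Σ_{τ ∈ S_d} ‖Σ_{η ∈ S_d} sgn(η) P_N T*_{η(1)} T_{τ(1)} T*_{η(2)} ··· T*_{η(d)} P_N^⊥ T_{τ(d)} P_N‖. -/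
open ContinuousLinearMap MeasureTheory
open scoped ENNReal NNReal ComplexOrder

noncomputable section

variable {H H₁ H₂ K : Type*}
variable [NormedAddCommGroup H] [InnerProductSpace ℂ H] [CompleteSpace H]
variable [NormedAddCommGroup H₁] [InnerProductSpace ℂ H₁] [CompleteSpace H₁]
variable [NormedAddCommGroup H₂] [InnerProductSpace ℂ H₂] [CompleteSpace H₂]
variable [NormedAddCommGroup K] [InnerProductSpace ℂ K] [CompleteSpace K]

section algebra_part
variable {R : Type*} [Ring R]

theorem aux_prod_congr {M : Type*} [Monoid M] : ∀ (n : ℕ) (f g : Fin n → M) (j : ℕ) (hj : j + 1 < n),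
    (∀ k : Fin n, (k : ℕ) ≠ j → (k : ℕ) ≠ j + 1 → f k = g k) →
    f ⟨j, by omega⟩ * f ⟨j + 1, hj⟩ = g ⟨j, by omega⟩ * g ⟨j + 1, hj⟩ →
    (List.ofFn f).prod = (List.ofFn g).prod
  | 0, _, _, j, hj, _, _ => by omega
  | 1, _, _, j, hj, _, _ => by omega
  | n + 2, f, g, 0, hj, h, h2 => by
    rw [List.ofFn_succ, List.ofFn_succ, List.ofFn_succ (f := g), List.ofFn_succ (f := fun i => g i.succ)]
    simp only [List.prod_cons, ← mul_assoc]
    have h3 : f 0 * f (Fin.succ 0) = g 0 * g (Fin.succ 0) := h2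
    rw [h3]
    congr 3
    funext k
    apply h <;> simp
  | n + 2, f, g, j + 1, hj, h, h2 => by
    rw [List.ofFn_succ, List.ofFn_succ (f := g)]
    simp only [List.prod_cons]
    rw [h 0 (by simp) (by simp),
      aux_prod_congr (n + 1) (fun i => f i.succ) (fun i => g i.succ) j (by omega) _ _]
    · intro k h3 h4
      apply h <;> simp <;> omega
    · exact h2

theorem aux_mul_prod {M : Type*} [Monoid M] (x : M) : ∀ (n : ℕ) (f g : Fin n → M) (j : Fin n),
    (∀ k, Commute x (f k)) → g j = x * f j → (∀ k, k ≠ j → g k = f k) →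
    x * (List.ofFn f).prod = (List.ofFn g).prod := by
  intro n
  induction n with
  | zero => intro f g j; exact j.elim0
  | succ n ih =>
    intro f g j hc hj hk
    rw [List.ofFn_succ, List.ofFn_succ (f := g)]
    simp only [List.prod_cons]
    induction j using Fin.cases with
    | zero =>
      rw [hj, mul_assoc]
      congr 4
      funext k
      exact (hk _ (Fin.succ_ne_zero k)).symm
    | succ j =>
      rw [hk 0 (Fin.succ_ne_zero j).symm, ← mul_assoc, (hc 0).eq, mul_assoc,
        ih (fun i => f i.succ) (fun i => g i.succ) j (fun k => hc _) hj]
      intro k hkj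
      exact hk _ (fun h => hkj (Fin.succ_injective _ h))

theorem aux_word_right {M : Type*} [Monoid M] (n : ℕ) (a t : Fin (n + 1) → M) :
    (List.ofFn fun k => a k * t k).prod =
    (List.ofFn fun k : Fin (n + 1) => if (k : ℕ) + 1 = n + 1 then a k else a k * t k).prod
      * t (Fin.last n) := by
  rw [List.ofFn_succ', List.ofFn_succ']
  simp [List.concat_eq_append, mul_assoc]
  congr 3
  funext k
  rw [if_neg]
  have := k.isLt
  omega

theorem aux_word_left {M : Type*} [Monoid M] : ∀ (n : ℕ) (a t s : Fin (n + 1) → M),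
    (∀ k : Fin n, s k.castSucc = t k.succ) →
    (List.ofFn fun k => t k * a k).prod = t 0 *
    (List.ofFn fun k : Fin (n + 1) => if (k : ℕ) + 1 = n + 1 then a k else a k * s k).prod := by
  intro n
  induction n with
  | zero => intro a t s h; simp
  | succ n ih =>
    intro a t s h
    rw [List.ofFn_succ, List.ofFn_succ (f := fun k : Fin (n + 1 + 1) =>
      if (k : ℕ) + 1 = n + 1 + 1 then a k else a k * s k)]
    simp only [List.prod_cons]
    rw [ih (fun i => a i.succ) (fun i => t i.succ) (fun i => s i.succ) (fun k => h k.succ)]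
    have h0 : s 0 = t (Fin.succ 0) := h 0
    simp [h0, mul_assoc]

/-- antisymmetrisation of a function invariant under an adjacent swap -/
theorem aux_antisym {M : Type*} [AddCommGroup M] {d : ℕ} (i j : Fin d) (hij : i ≠ j)
    (F : Equiv.Perm (Fin d) → M) (hF : ∀ τ, F (τ * Equiv.swap i j) = F τ) :
    ∑ τ : Equiv.Perm (Fin d), (Equiv.Perm.sign τ : ℤ) • F τ = 0 := by
  refine Finset.sum_involution (fun τ _ => τ * Equiv.swap i j) ?_ ?_ ?_ ?_
  · intro τ _
    rw [hF, Equiv.Perm.sign_mul, Equiv.Perm.sign_swap hij]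
    simp
  · intro τ _ _ h
    have : Equiv.swap i j = 1 := by simpa using h
    exact hij (Equiv.swap_eq_one_iff.mp this)
  · intro τ _; exact Finset.mem_univ _
  · intro τ _
    simp [mul_assoc]

theorem aux_exists_switch {n : ℕ} (s : Finset (Fin (n + 1))) (h1 : s ≠ Finset.univ) (h2 : s ≠ ∅) :
    ∃ j : ℕ, ∃ hj : j + 1 < n + 1,
      ¬ ((⟨j, by omega⟩ : Fin (n+1)) ∈ s ↔ (⟨j + 1, hj⟩ : Fin (n+1)) ∈ s) := by
  by_contra hcon
  push Not at hcon
  have key : ∀ j : ℕ, ∀ hj : j < n + 1, ((⟨j, hj⟩ : Fin (n+1)) ∈ s ↔ (0 : Fin (n+1)) ∈ s) := by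
    intro j
    induction j with
    | zero => intro hj; rfl
    | succ j ih => intro hj; rw [← hcon j hj, ih]
  by_cases h0 : (0 : Fin (n+1)) ∈ s
  · exact h1 (Finset.eq_univ_of_forall fun k => (key k k.isLt).2 h0)
  · exact h2 (Finset.eq_empty_of_forall_notMem fun k hk => h0 ((key k k.isLt).1 hk))

theorem aux_expand {n : ℕ} (f g : Fin n → R) :
    (List.ofFn fun k => f k + g k).prod =
      ∑ s : Finset (Fin n), (List.ofFn (s.piecewise f g)).prod := by
  have := (MultilinearMap.mkPiAlgebraFin ℤ n R).map_add_univ f g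
  simp only [MultilinearMap.mkPiAlgebraFin_apply] at this
  exact this

theorem aux_vanish {n : ℕ} (a t : Fin (n + 1) → R) (ha : ∀ i j, Commute (a i) (a j))
    (ht : ∀ i j, Commute (t i) (t j)) (s : Finset (Fin (n + 1)))
    (h1 : s ≠ Finset.univ) (h2 : s ≠ ∅) :
    ∑ η : Equiv.Perm (Fin (n + 1)), ∑ τ : Equiv.Perm (Fin (n + 1)),
      (Equiv.Perm.sign η : ℤ) • (Equiv.Perm.sign τ : ℤ) •
      (List.ofFn (s.piecewise (fun k => a (η k) * t (τ k)) (fun k => - (t (τ k) * a (η k))))).prod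
      = 0 := by
  obtain ⟨j, hj, hs⟩ := aux_exists_switch s h1 h2
  have hne : (⟨j, by omega⟩ : Fin (n+1)) ≠ ⟨j + 1, hj⟩ := by simp
  have hfix : ∀ k : Fin (n+1), (k : ℕ) ≠ j → (k : ℕ) ≠ j + 1 →
      Equiv.swap (⟨j, by omega⟩ : Fin (n+1)) ⟨j + 1, hj⟩ k = k := by
    intro k hk1 hk2
    apply Equiv.swap_apply_of_ne_of_ne
    · intro h; exact hk1 (by rw [h])
    · intro h; exact hk2 (by rw [h])
  by_cases hjs : (⟨j, by omega⟩ : Fin (n+1)) ∈ s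
  · have hjs' : (⟨j + 1, hj⟩ : Fin (n+1)) ∉ s := fun h => hs ⟨fun _ => h, fun _ => hjs⟩
    refine Finset.sum_eq_zero fun η _ => ?_
    rw [← Finset.smul_sum]
    rw [aux_antisym _ _ hne, smul_zero]
    intro τ
    apply aux_prod_congr _ _ _ j hj
    · intro k hk1 hk2
      simp only [Finset.piecewise, Equiv.Perm.mul_apply, hfix k hk1 hk2]
    · simp only [Finset.piecewise, hjs, hjs', if_true, if_false, Equiv.Perm.mul_apply,
        Equiv.swap_apply_left, Equiv.swap_apply_right]
      simp only [mul_neg, neg_inj, mul_assoc]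
      rw [← mul_assoc (t _) (t _), (ht _ _).eq, mul_assoc]
  · have hjs' : (⟨j + 1, hj⟩ : Fin (n+1)) ∈ s := by tauto
    rw [Finset.sum_comm]
    refine Finset.sum_eq_zero fun τ _ => ?_
    simp only [smul_comm (_ : ℤ) (Equiv.Perm.sign τ : ℤ)]
    rw [← Finset.smul_sum]
    rw [aux_antisym _ _ hne, smul_zero]
    intro η
    apply aux_prod_congr _ _ _ j hj
    · intro k hk1 hk2
      simp only [Finset.piecewise, Equiv.Perm.mul_apply, hfix k hk1 hk2]
    · simp only [Finset.piecewise, hjs, hjs', if_true, if_false, Equiv.Perm.mul_apply,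
        Equiv.swap_apply_left, Equiv.swap_apply_right]
      simp only [neg_mul, neg_inj, mul_assoc]
      rw [← mul_assoc (a _) (a _), (ha _ _).eq, mul_assoc]

theorem aux_prod_neg {n : ℕ} (f : Fin n → R) :
    (List.ofFn fun k => - f k).prod = (-1 : ℤ) ^ n • (List.ofFn f).prod := by
  induction n with
  | zero => simp
  | succ n ih =>
    rw [List.ofFn_succ, List.ofFn_succ (f := f), List.prod_cons, List.prod_cons, ih]
    rw [mul_smul_comm, pow_succ, mul_smul, neg_mul, neg_one_smul]

theorem aux_main {n : ℕ} (a t : Fin (n + 1) → R) (ha : ∀ i j, Commute (a i) (a j))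
    (ht : ∀ i j, Commute (t i) (t j)) (W : Equiv.Perm (Fin (n + 1)) → Equiv.Perm (Fin (n + 1)) → R)
    (hW : ∀ η τ, W η τ = (List.ofFn fun k : Fin (n + 1) =>
      if (k : ℕ) + 1 = n + 1 then a (η k) else a (η k) * t (τ k)).prod) :
    ∑ σ : Equiv.Perm (Fin (n + 1)), ∑ τ : Equiv.Perm (Fin (n + 1)),
      (Equiv.Perm.sign σ : ℤ) •
        (List.ofFn fun k => a (σ (τ k)) * t (τ k) - t (τ k) * a (σ (τ k))).prod
    = ∑ τ : Equiv.Perm (Fin (n + 1)), (Equiv.Perm.sign τ : ℤ) •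
        ((∑ η : Equiv.Perm (Fin (n + 1)), (Equiv.Perm.sign η : ℤ) • W η τ) * t (τ (Fin.last n))
        - t (τ (Fin.last n)) * ∑ η : Equiv.Perm (Fin (n + 1)), (Equiv.Perm.sign η : ℤ) • W η τ) := by
  have e1 : ∑ σ : Equiv.Perm (Fin (n + 1)), ∑ τ : Equiv.Perm (Fin (n + 1)),
      (Equiv.Perm.sign σ : ℤ) •
        (List.ofFn fun k => a (σ (τ k)) * t (τ k) - t (τ k) * a (σ (τ k))).prod
      = ∑ η : Equiv.Perm (Fin (n + 1)), ∑ τ : Equiv.Perm (Fin (n + 1)),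
      (Equiv.Perm.sign η : ℤ) • (Equiv.Perm.sign τ : ℤ) •
        (List.ofFn fun k => a (η k) * t (τ k) + -(t (τ k) * a (η k))).prod := by
    rw [Finset.sum_comm]
    conv_rhs => rw [Finset.sum_comm]
    refine Finset.sum_congr rfl fun τ _ => ?_
    refine Fintype.sum_equiv (Equiv.mulRight τ) _ _ fun σ => ?_
    simp only [Equiv.coe_mulRight, Equiv.Perm.sign_mul, Equiv.Perm.mul_apply, sub_eq_add_neg,
      smul_smul]
    congr 1
    rcases Int.units_eq_one_or (Equiv.Perm.sign τ) with h | h <;> simp [h]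
  rw [e1]
  simp only [aux_expand, Finset.smul_sum]
  have e2 : ∀ F : Equiv.Perm (Fin (n + 1)) → Equiv.Perm (Fin (n + 1)) → Finset (Fin (n + 1)) → R,
      ∑ η, ∑ τ, ∑ s, F η τ s = ∑ s, ∑ η, ∑ τ, F η τ s := by
    intro F
    simp only [Finset.sum_comm (s := (Finset.univ : Finset (Equiv.Perm (Fin (n+1)))))
      (t := (Finset.univ : Finset (Finset (Fin (n+1)))))]
  rw [e2]
  rw [Finset.sum_eq_add_of_mem (Finset.univ : Finset (Fin (n + 1))) ∅ (Finset.mem_univ _)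
    (Finset.mem_univ _) (Finset.univ_nonempty.ne_empty)
    (fun s _ hs => aux_vanish a t ha ht s hs.1 hs.2)]
  simp only [smul_sub, Finset.sum_sub_distrib, sub_eq_add_neg (∑ τ, _ : R)]
  congr 1
  · rw [Finset.sum_comm]
    refine Finset.sum_congr rfl fun τ _ => ?_
    rw [Finset.sum_mul, Finset.smul_sum]
    refine Finset.sum_congr rfl fun η _ => ?_
    rw [Finset.piecewise_univ, aux_word_right n (fun k => a (η k)) (fun k => t (τ k)), hW,
      smul_comm, smul_mul_assoc]
  · rw [Finset.sum_comm, ← Finset.sum_neg_distrib]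
    refine Fintype.sum_equiv (Equiv.mulRight (finRotate (n + 1))) _ _ fun τ => ?_
    rw [Finset.mul_sum, Finset.smul_sum, ← Finset.sum_neg_distrib]
    refine Finset.sum_congr rfl fun η _ => ?_
    rw [Finset.piecewise_empty, aux_prod_neg, aux_word_left n (fun k => a (η k)) (fun k => t (τ k))
      (fun k => t ((τ * finRotate (n + 1)) k)), hW]
    · simp only [Equiv.coe_mulRight, Equiv.Perm.sign_mul, sign_finRotate, Equiv.Perm.mul_apply,
        finRotate_last, mul_smul_comm, smul_smul, ← neg_smul]
      congr 1
      push_cast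
      ring
    · intro k
      simp [Equiv.Perm.mul_apply]
end algebra_part
section trace_part

theorem aux_trace {ι : Type*} (b : HilbertBasis ι ℂ H) (A : H →L[ℂ] H) (V : Submodule ℂ H)
    [FiniteDimensional ℂ V] (hA : ∀ x, A x ∈ V) {r : ℕ} (e : OrthonormalBasis (Fin r) ℂ V) :
    HasSum (fun i => inner ℂ (b i) (A (b i))) (∑ k, inner ℂ (e k : H) (A (e k))) := by
  have h1 : ∀ k, HasSum (fun i => inner ℂ (adjoint A (e k)) (b i) * inner ℂ (b i) (e k : H))
      (inner ℂ (e k : H) (A (e k))) := by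
    intro k
    rw [← adjoint_inner_left]
    exact b.hasSum_inner_mul_inner _ _
  have h2 := hasSum_sum (s := Finset.univ) (fun k _ => h1 k)
  convert h2 using 2 with i
  have h3 : A (b i) = ∑ k, inner ℂ (e k : H) (A (b i)) • (e k : H) := by
    have := congrArg (Subtype.val) (e.sum_repr' ⟨A (b i), hA _⟩)
    simpa using this.symm
  conv_lhs => rw [h3]
  rw [inner_sum]
  refine Finset.sum_congr rfl fun k _ => ?_
  rw [inner_smul_right, adjoint_inner_left]

theorem aux_trace_bound {ι : Type*} (b : HilbertBasis ι ℂ H) (A : H →L[ℂ] H) (V : Submodule ℂ H)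
    [FiniteDimensional ℂ V] (hA : ∀ x, A x ∈ V) :
    ∃ c : ℂ, HasSum (fun i => inner ℂ (b i) (A (b i))) c ∧
      ‖c‖ ≤ Module.finrank ℂ V * ‖A‖ := by
  refine ⟨_, aux_trace b A V hA (stdOrthonormalBasis ℂ V), ?_⟩
  refine (norm_sum_le _ _).trans ?_
  refine (Finset.sum_le_card_nsmul _ _ ‖A‖ fun k _ => ?_).trans ?_
  · have h1 : ‖((stdOrthonormalBasis ℂ V k : V) : H)‖ = 1 := by
      exact (stdOrthonormalBasis ℂ V).orthonormal.1 k
    refine (norm_inner_le_norm _ _).trans ?_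
    rw [h1, one_mul]
    simpa [h1] using A.le_opNorm (stdOrthonormalBasis ℂ V k : H)
  · simp

theorem aux_proj_eq {P : H →L[ℂ] H} {V : Submodule ℂ H} (hP : IsOrthProjOn P V)
    [FiniteDimensional ℂ V] {r : ℕ} (e : OrthonormalBasis (Fin r) ℂ V) (y : H) :
    P y = ∑ k, inner ℂ (e k : H) y • (e k : H) := by
  have := congrArg (Subtype.val) (e.sum_repr' ⟨P y, hP.2.1 _⟩)
  have h2 : P y = ∑ k, inner ℂ (e k : H) (P y) • (e k : H) := by simpa using this.symm
  rw [h2]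
  refine Finset.sum_congr rfl fun k _ => ?_
  rw [← adjoint_inner_left, hP.1.adjoint_eq, hP.2.2 _ (e k).2]

theorem aux_trace_comm {ι : Type*} (b : HilbertBasis ι ℂ H) {P : H →L[ℂ] H} {V : Submodule ℂ H}
    (hP : IsOrthProjOn P V) [FiniteDimensional ℂ V] (X Y : H →L[ℂ] H) :
    HasSum (fun i => inner ℂ (b i) ((P * X * P * Y * P - P * Y * P * X * P) (b i))) 0 := by
  have h := aux_trace b (P * X * P * Y * P - P * Y * P * X * P) V (fun x =>
    V.sub_mem (hP.2.1 _) (hP.2.1 _)) (stdOrthonormalBasis ℂ V)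
  convert h using 1
  set e := stdOrthonormalBasis ℂ V
  have key : ∀ X Y : H →L[ℂ] H, ∀ k, inner ℂ (e k : H) ((P * X * P * Y * P) (e k)) =
      ∑ l, inner ℂ (e k : H) (X (e l)) * inner ℂ (e l : H) (Y (e k)) := by
    intro X Y k
    simp only [mul_apply_eq_comp]
    rw [← adjoint_inner_left, hP.1.adjoint_eq, hP.2.2 _ (e k).2, aux_proj_eq hP e, map_sum,
      inner_sum]
    refine Finset.sum_congr rfl fun l _ => ?_
    rw [map_smul, inner_smul_right, mul_comm]
  simp only [_root_.sub_apply, inner_sub_right, Finset.sum_sub_distrib, key]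
  rw [eq_comm, sub_eq_zero, Finset.sum_comm]
  refine Finset.sum_congr rfl fun k _ => Finset.sum_congr rfl fun l _ => mul_comm _ _

theorem aux_opWord {d : ℕ} (T : Fin d → H →L[ℂ] H) (hcomm : ∀ i j, Commute (T i) (T j))
    (j : Fin d) (n : Fin d → ℕ) : T j * opWord T n = opWord T (n + Pi.single j 1) := by
  unfold opWord
  refine aux_mul_prod (T j) d _ _ j (fun k => (hcomm j k).pow_right _) ?_ ?_
  · simp [pow_succ']
  · intro k hk
    simp [hk]

theorem aux_HN_fin {d : ℕ} (T : Fin d → H →L[ℂ] H) (ξ : Finset H) (N : ℕ) :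
    FiniteDimensional ℂ (HN T ξ N) := by
  apply FiniteDimensional.span_of_finite
  apply Set.Finite.subset ((ξ.finite_toSet.prod (Set.finite_Iic (fun _ : Fin d => N))).image
    (fun p => opWord T p.2 p.1))
  rintro x ⟨v, hv, n, hn, rfl⟩
  refine ⟨(v, n), ⟨hv, fun j => ?_⟩, rfl⟩
  exact (Finset.single_le_sum (f := n) (fun _ _ => Nat.zero_le _) (Finset.mem_univ j)).trans hn

open Classical in
theorem aux_range {d : ℕ} (T : Fin d → H →L[ℂ] H) (hcomm : ∀ i j, Commute (T i) (T j))
    (ξ : Finset H) (N : ℕ) (P : H →L[ℂ] H) (hP : IsOrthProjOn P (HN T ξ N)) (j : Fin d)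
    (X : H →L[ℂ] H) (x : H) :
    (X * ((1 - P) * T j * P)) x ∈ Submodule.span ℂ
      (((ξ ×ˢ (Finset.finsuppAntidiag (Finset.univ : Finset (Fin d)) N)).image
        (fun p => (X * ((1 - P) * T j)) (opWord T p.2 p.1)) : Finset H) : Set H) := by
  set S := Submodule.span ℂ
      (((ξ ×ˢ (Finset.finsuppAntidiag (Finset.univ : Finset (Fin d)) N)).image
        (fun p => (X * ((1 - P) * T j)) (opWord T p.2 p.1)) : Finset H) : Set H) with hS
  have key : HN T ξ N ≤ S.comap ((X * ((1 - P) * T j) : H →L[ℂ] H) : H →ₗ[ℂ] H) := by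
    apply Submodule.span_le.2
    rintro y ⟨v, hv, n, hn, rfl⟩
    show (X * ((1 - P) * T j)) (opWord T n v) ∈ S
    rcases hn.lt_or_eq with hlt | heq
    · have h1 : T j (opWord T n v) ∈ HN T ξ N := by
        apply Submodule.subset_span
        refine ⟨v, hv, n + Pi.single j 1, ?_, ?_⟩
        · simp [Finset.sum_add_distrib]; omega
        · rw [← aux_opWord T hcomm]; rfl
      have h2 : (X * ((1 - P) * T j)) (opWord T n v) = 0 := by
        simp [hP.2.2 _ h1]
      rw [h2]; exact S.zero_mem
    · apply Submodule.subset_span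
      rw [Finset.mem_coe, Finset.mem_image]
      refine ⟨(v, Finsupp.equivFunOnFinite.symm n), ?_, by simp⟩
      rw [Finset.mem_product, Finset.mem_finsuppAntidiag]
      exact ⟨hv, by simpa using heq, by simp⟩
  exact key (hP.2.1 x)

end trace_part

/-- the trace estimate for the compression `P_N dEt[[T*,T]] P_N`. -/
theorem statement_16 {d : ℕ} (hd : 0 < d) {ι : Type*} [TopologicalSpace.SeparableSpace H]
    (T : Fin d → H →L[ℂ] H) (hcomm : ∀ i j, Commute (T i) (T j))
    (m : ℕ) (hcyc : IsPolyCyclicTuple T m)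
    (ξ : Finset H) (hcard : ξ.card = m)
    (hdense : Dense ((Submodule.span ℂ
        {x | ∃ v ∈ ξ, ∃ n : Fin d → ℕ, x = opWord T n v} : Submodule ℂ H) : Set H))
    (P : ℕ → H →L[ℂ] H) (hP : ∀ N, IsOrthProjOn (P N) (HN T ξ N))
    (hPT : ∀ (N : ℕ) (j : Fin d), P N * T j * (1 - P N) = 0)
    (N : ℕ) (b : HilbertBasis ι ℂ H) :
    Summable (fun i => @inner ℂ _ _ (b i) ((P N * detOp T * P N) (b i))) ∧
    ‖∑' i, @inner ℂ _ _ (b i) ((P N * detOp T * P N) (b i))‖ ≤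
      (m * (N + d - 1).choose (d - 1) : ℝ) *
        ∑ τ : Equiv.Perm (Fin d), ‖bsExpr hd T P τ N‖ := by
  classical
  obtain ⟨n, rfl⟩ : ∃ n, d = n + 1 := ⟨d - 1, by omega⟩
  have := aux_HN_fin T ξ N
  set X : Equiv.Perm (Fin (n + 1)) → H →L[ℂ] H := fun τ =>
    ∑ η : Equiv.Perm (Fin (n + 1)), (Equiv.Perm.sign η : ℤ) • wordB T η τ with hX
  have hdet : detOp T = ∑ τ : Equiv.Perm (Fin (n + 1)), (Equiv.Perm.sign τ : ℤ) •
      (X τ * T (τ (Fin.last n)) - T (τ (Fin.last n)) * X τ) := by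
    refine aux_main (fun k => adjoint (T k)) T ?_ hcomm (wordB T) (fun η τ => rfl)
    intro i j
    have := (hcomm i j).star_star
    rwa [ContinuousLinearMap.star_eq_adjoint, ContinuousLinearMap.star_eq_adjoint] at this
  have hPP : P N * P N = P N := by
    ext x
    exact (hP N).2.2 _ ((hP N).2.1 x)
  have hsplit : ∀ τ, P N * (X τ * T (τ (Fin.last n)) - T (τ (Fin.last n)) * X τ) * P N =
      (P N * X τ * P N * T (τ (Fin.last n)) * P N - P N * T (τ (Fin.last n)) * P N * X τ * P N)
        + bsExpr hd T P τ N := by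
    intro τ
    have h1 : P N * T (τ (Fin.last n)) = P N * T (τ (Fin.last n)) * P N := by
      have := hPT N (τ (Fin.last n))
      rw [mul_sub, mul_one, sub_eq_zero] at this
      exact this
    have h2 : bsExpr hd T P τ N = P N * X τ * ((1 - P N) * T (τ (Fin.last n)) * P N) := rfl
    rw [h2, ← h1]
    noncomm_ring
  have hbs : ∀ τ, ∃ c : ℂ,
      HasSum (fun i => inner ℂ (b i) ((bsExpr hd T P τ N) (b i))) c ∧
      ‖c‖ ≤ (m * (N + (n + 1) - 1).choose ((n + 1) - 1) : ℝ) * ‖bsExpr hd T P τ N‖ := by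
    intro τ
    obtain ⟨c, hc, hle⟩ := aux_trace_bound b (bsExpr hd T P τ N) _
      (aux_range T hcomm ξ N (P N) (hP N) (τ (Fin.last n)) (P N * X τ))
    refine ⟨c, hc, hle.trans ?_⟩
    refine mul_le_mul_of_nonneg_right ?_ (norm_nonneg _)
    have h3 := (finrank_span_finset_le_card (R := ℂ)
      ((ξ ×ˢ (Finset.finsuppAntidiag (Finset.univ : Finset (Fin (n + 1))) N)).image
        (fun p => (P N * X τ * ((1 - P N) * T (τ (Fin.last n)))) (opWord T p.2 p.1)))).trans
      Finset.card_image_le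
    rw [Finset.card_product, hcard, Finset.card_finsuppAntidiag_nat_eq_choose] at h3
    have h4 : ((Finset.univ : Finset (Fin (n + 1))).card + N - 1).choose N
        = (N + (n + 1) - 1).choose ((n + 1) - 1) := by
      simp only [Finset.card_univ, Fintype.card_fin]
      rw [show n + 1 + N - 1 = N + n by omega, show N + (n + 1) - 1 = N + n by omega,
        Nat.add_sub_cancel]
      exact Nat.choose_symm_add
    rw [h4] at h3
    exact_mod_cast h3
  choose c hc hcle using hbs
  have hsum : HasSum (fun i => inner ℂ (b i) ((P N * detOp T * P N) (b i)))
      (∑ τ : Equiv.Perm (Fin (n + 1)), ((Equiv.Perm.sign τ : ℤ) : ℂ) * (0 + c τ)) := by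
    have h5 := hasSum_sum (s := Finset.univ) (fun (τ : Equiv.Perm (Fin (n + 1))) _ =>
      ((aux_trace_comm b (hP N) (X τ) (T (τ (Fin.last n)))).add (hc τ)).mul_left
        ((Equiv.Perm.sign τ : ℤ) : ℂ))
    refine h5.congr_fun fun i => ?_
    rw [hdet, Finset.mul_sum, Finset.sum_mul, _root_.sum_apply, inner_sum]
    refine Finset.sum_congr rfl fun τ _ => ?_
    rw [mul_smul_comm, smul_mul_assoc, hsplit, ← inner_add_right, ← _root_.add_apply]
    generalize (_ + bsExpr hd T P τ N : H →L[ℂ] H) = Z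
    rcases Int.units_eq_one_or (Equiv.Perm.sign τ) with h | h <;> simp [h]
  refine ⟨hsum.summable, ?_⟩
  rw [hsum.tsum_eq, Finset.mul_sum]
  refine (norm_sum_le _ _).trans (Finset.sum_le_sum fun τ _ => ?_)
  refine le_trans (le_of_eq ?_) (hcle τ)
  rcases Int.units_eq_one_or (Equiv.Perm.sign τ) with h | h <;> simp [h]
end
end
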